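/- Hardy–Littlewood type theorem for the class M_p: let f ∈ M_p, 1<p<∞, and r₁,r₂ ≥ 0. Then ‖f‖_p ≍ (Σ_{ν₁=1}^∞ Σ_{ν₂=1}^∞ a_{ν₁,ν₂}^p (ν₁ν₂)^{p−2})^{1/p}, and ‖f^{(r₁,r₂)}‖_p ≍ (Σ_{ν₁=1}^∞ Σ_{ν₂=1}^∞ a_{ν₁,ν₂}^p ν₁^{r₁p+p−2} ν₂^{r₂p+p−2})^{1/p}, in the sense that in each equivalence either side is finite if and only if the other is, with constants independent of f (in particular, f has a mixed Weyl derivative f^{(r₁,r₂)} ∈ L_p(T²) if and only if the last sum converges). -/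

import Mathlib

open MeasureTheory Real
open scoped ENNReal

noncomputable section

/-- The `L_p` norm of a function of two variables over the period square `(0,2π]²`. -/
def Lp2Norm (p : ℝ) (f : ℝ → ℝ → ℝ) : ℝ≥0∞ :=
  (∫⁻ x in Set.Ioc (0:ℝ) (2*π), ∫⁻ y in Set.Ioc (0:ℝ) (2*π),
      ENNReal.ofReal (|f x y| ^ p)) ^ (1/p)

/-- `f ∈ L_p^0(T²)`: measurable, `2π`-periodic in each variable, finite `L_p` norm,
and zero mean in each variable separately. -/
structure MemLp0 (p : ℝ) (f : ℝ → ℝ → ℝ) : Prop where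
  meas : Measurable (Function.uncurry f)
  periodic_x : ∀ y, Function.Periodic (fun x => f x y) (2*π)
  periodic_y : ∀ x, Function.Periodic (f x) (2*π)
  norm_ne_top : Lp2Norm p f ≠ ⊤
  mean_x : ∀ᵐ (y : ℝ) ∂volume, (∫ x in (0:ℝ)..(2*π), f x y) = 0
  mean_y : ∀ᵐ (x : ℝ) ∂volume, (∫ y in (0:ℝ)..(2*π), f x y) = 0

/-- Generalized (fractional) binomial coefficient `C(α,ν) = α(α-1)⋯(α-ν+1)/ν!`. -/
def fracBinom (α : ℝ) : ℕ → ℝ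
  | 0 => 1
  | n+1 => fracBinom α n * (α - (n : ℝ)) / ((n : ℝ) + 1)

/-- Fractional difference of order `α` with step `h` in the first variable. -/
def diffX (α h : ℝ) (f : ℝ → ℝ → ℝ) : ℝ → ℝ → ℝ :=
  fun x y => ∑' ν : ℕ, (-1 : ℝ) ^ ν * fracBinom α ν * f (x + (α - (ν : ℝ)) * h) y

/-- Fractional difference of order `α` with step `h` in the second variable. -/
def diffY (α h : ℝ) (f : ℝ → ℝ → ℝ) : ℝ → ℝ → ℝ :=
  fun x y => ∑' ν : ℕ, (-1 : ℝ) ^ ν * fracBinom α ν * f x (y + (α - (ν : ℝ)) * h)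

/-- The mixed (fractional) modulus of smoothness `ω_{α₁,α₂}(f, δ₁, δ₂)_p`. -/
def mixedMod (p α₁ α₂ δ₁ δ₂ : ℝ) (f : ℝ → ℝ → ℝ) : ℝ≥0∞ :=
  ⨆ (h₁ : ℝ) (_ : |h₁| ≤ δ₁) (h₂ : ℝ) (_ : |h₂| ≤ δ₂),
    Lp2Norm p (diffX α₁ h₁ (diffY α₂ h₂ f))

/-- Cosine-cosine Fourier coefficient `a_{n₁,n₂}` of `f`. -/
def fourierCC (f : ℝ → ℝ → ℝ) (n₁ n₂ : ℕ) : ℝ :=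
  (1/π^2) * ∫ x in (0:ℝ)..(2*π), ∫ y in (0:ℝ)..(2*π),
    f x y * Real.cos ((n₁ : ℝ) * x) * Real.cos ((n₂ : ℝ) * y)

/-- Sine-cosine Fourier coefficient `b_{n₁,n₂}` of `f`. -/
def fourierSC (f : ℝ → ℝ → ℝ) (n₁ n₂ : ℕ) : ℝ :=
  (1/π^2) * ∫ x in (0:ℝ)..(2*π), ∫ y in (0:ℝ)..(2*π),
    f x y * Real.sin ((n₁ : ℝ) * x) * Real.cos ((n₂ : ℝ) * y)

/-- Cosine-sine Fourier coefficient `c_{n₁,n₂}` of `f`. -/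
def fourierCS (f : ℝ → ℝ → ℝ) (n₁ n₂ : ℕ) : ℝ :=
  (1/π^2) * ∫ x in (0:ℝ)..(2*π), ∫ y in (0:ℝ)..(2*π),
    f x y * Real.cos ((n₁ : ℝ) * x) * Real.sin ((n₂ : ℝ) * y)

/-- Sine-sine Fourier coefficient `d_{n₁,n₂}` of `f`. -/
def fourierSS (f : ℝ → ℝ → ℝ) (n₁ n₂ : ℕ) : ℝ :=
  (1/π^2) * ∫ x in (0:ℝ)..(2*π), ∫ y in (0:ℝ)..(2*π),
    f x y * Real.sin ((n₁ : ℝ) * x) * Real.sin ((n₂ : ℝ) * y)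

/-- The class `M_p`: `f ∈ L_p^0(T²)` with a pure cosine-cosine Fourier series
`Σ a_{ν₁,ν₂} cos ν₁x cos ν₂y` whose coefficients have nonnegative mixed differences. -/
def InMclass (p : ℝ) (f : ℝ → ℝ → ℝ) (a : ℕ → ℕ → ℝ) : Prop :=
  MemLp0 p f ∧
  (∀ ν₁ ν₂ : ℕ, 1 ≤ ν₁ → 1 ≤ ν₂ → fourierCC f ν₁ ν₂ = a ν₁ ν₂) ∧
  (∀ n₁ n₂ : ℕ, fourierSC f n₁ n₂ = 0 ∧ fourierCS f n₁ n₂ = 0 ∧ fourierSS f n₁ n₂ = 0) ∧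
  (∀ ν₁ ν₂ : ℕ, 1 ≤ ν₁ → 1 ≤ ν₂ →
    0 ≤ a ν₁ ν₂ - a (ν₁+1) ν₂ - a ν₁ (ν₂+1) + a (ν₁+1) (ν₂+1))

/-- Complex Fourier coefficient of a (real-valued) function on `T²`. -/
def fourierCoefZ (f : ℝ → ℝ → ℝ) (m₁ m₂ : ℤ) : ℂ :=
  (((2*π)^2)⁻¹ : ℝ) * ∫ x in (0:ℝ)..(2*π), ∫ y in (0:ℝ)..(2*π),
    (f x y : ℂ) * Complex.exp (-Complex.I * ((m₁ : ℂ) * (x : ℂ) + (m₂ : ℂ) * (y : ℂ)))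

/-- `g` is the mixed Weyl derivative `f^{(ρ₁,ρ₂)}` of `f` (and `g ∈ L_p^0(T²)`):
the Fourier coefficients of `g` arise from those of `f` by multiplication
with `(i m₁)^{ρ₁} (i m₂)^{ρ₂}`. -/
def HasWeylDeriv (p ρ₁ ρ₂ : ℝ) (f g : ℝ → ℝ → ℝ) : Prop :=
  MemLp0 p g ∧ ∀ m₁ m₂ : ℤ,
    fourierCoefZ g m₁ m₂ =
      (Complex.I * (m₁ : ℂ)) ^ (ρ₁ : ℂ) * (Complex.I * (m₂ : ℂ)) ^ (ρ₂ : ℂ) * fourierCoefZ f m₁ m₂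

/-- The Hardy–Littlewood type sum `(Σ a_{ν₁,ν₂}^p ν₁^{r₁p+p-2} ν₂^{r₂p+p-2})^{1/p}`. -/
def MclassSum (a : ℕ → ℕ → ℝ) (p r₁ r₂ : ℝ) : ℝ≥0∞ :=
  (∑' (ν₁ : ℕ) (ν₂ : ℕ), ENNReal.ofReal
    (a (ν₁+1) (ν₂+1) ^ p * ((ν₁+1 : ℕ) : ℝ) ^ (r₁*p+p-2) *
      ((ν₂+1 : ℕ) : ℝ) ^ (r₂*p+p-2))) ^ (1/p)

open scoped NNReal

/-- Abel summation: a weighted sum is controlled by the partial sums and the variation of the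
weights. -/
lemma abs_sum_mul_le_of_variation (G u : ℕ → ℝ) (U : ℝ) (m n : ℕ) (hmn : m ≤ n)
    (hU : ∀ j ≤ n, |∑ ν ∈ Finset.Ico m j, u ν| ≤ U) :
    |∑ ν ∈ Finset.Ico m n, G ν * u ν| ≤
      U * (|G n| + ∑ ν ∈ Finset.Ico m n, |G ν - G (ν + 1)|) := by
  have key : ∀ n, m ≤ n → ∑ ν ∈ Finset.Ico m n, G ν * u ν =
      G n * ∑ ν ∈ Finset.Ico m n, u ν +
        ∑ ν ∈ Finset.Ico m n, (G ν - G (ν + 1)) * ∑ i ∈ Finset.Ico m (ν + 1), u i := by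
    intro n hn
    induction n, hn using Nat.le_induction with
    | base => simp
    | succ n hn ih =>
      rw [Finset.sum_Ico_succ_top hn, ih,
        Finset.sum_Ico_succ_top hn (fun ν => (G ν - G (ν + 1)) * _),
        Finset.sum_Ico_succ_top hn u]
      ring
  rw [key n hmn]
  calc _ ≤ |G n * ∑ ν ∈ Finset.Ico m n, u ν| +
        ∑ ν ∈ Finset.Ico m n, |(G ν - G (ν + 1)) * ∑ i ∈ Finset.Ico m (ν + 1), u i| :=
        (abs_add_le _ _).trans (add_le_add le_rfl (Finset.abs_sum_le_sum_abs _ _))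
    _ ≤ |G n| * U + ∑ ν ∈ Finset.Ico m n, |G ν - G (ν + 1)| * U := by
        simp only [abs_mul]
        gcongr with ν hν
        · exact hU n le_rfl
        · exact hU _ (Finset.mem_Ico.1 hν).2
    _ = _ := by rw [← Finset.sum_mul]; ring

lemma sum_Ico_sub_succ (b : ℕ → ℝ) (m n : ℕ) (hmn : m ≤ n) :
    ∑ ν ∈ Finset.Ico m n, (b ν - b (ν + 1)) = b m - b n := by
  have h := Finset.sum_Ico_sub b hmn
  rw [← neg_sub (b n), ← h, ← Finset.sum_neg_distrib]
  exact Finset.sum_congr rfl fun _ _ => by ring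

lemma abs_sum_mul_le_of_majorant (G b u : ℕ → ℝ) (U : ℝ) (m n : ℕ) (hmn : m ≤ n)
    (hU : ∀ j ≤ n, |∑ ν ∈ Finset.Ico m j, u ν| ≤ U) (hG : ∀ ν ≥ m, |G ν| ≤ b ν)
    (hv : ∀ ν ≥ m, |G ν - G (ν + 1)| ≤ b ν - b (ν + 1)) :
    |∑ ν ∈ Finset.Ico m n, G ν * u ν| ≤ U * b m := by
  have hU0 : 0 ≤ U := (abs_nonneg _).trans (hU n le_rfl)
  refine (abs_sum_mul_le_of_variation G u U m n hmn hU).trans ?_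
  refine mul_le_mul_of_nonneg_left ?_ hU0
  calc _ ≤ b n + ∑ ν ∈ Finset.Ico m n, (b ν - b (ν + 1)) :=
        add_le_add (hG n hmn) (Finset.sum_le_sum fun ν hν => hv ν (Finset.mem_Ico.1 hν).1)
    _ = b m := by rw [sum_Ico_sub_succ b m n hmn]; ring

/-- A double sequence which is nonnegative, decreasing in each index, with nonnegative mixed
differences (for indices at least one). -/
structure DoublyMonotone (a : ℕ → ℕ → ℝ) : Prop where
  nonneg : ∀ i j, 1 ≤ i → 1 ≤ j → 0 ≤ a i j
  succ_le_left : ∀ i j, 1 ≤ i → 1 ≤ j → a (i + 1) j ≤ a i j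
  succ_le_right : ∀ i j, 1 ≤ i → 1 ≤ j → a i (j + 1) ≤ a i j
  mixed : ∀ i j, 1 ≤ i → 1 ≤ j → 0 ≤ a i j - a (i + 1) j - a i (j + 1) + a (i + 1) (j + 1)

lemma DoublyMonotone.anti {a : ℕ → ℕ → ℝ} (ha : DoublyMonotone a) {i j i' j' : ℕ} (hi : 1 ≤ i)
    (hj : 1 ≤ j) (hii : i ≤ i') (hjj : j ≤ j') : a i' j' ≤ a i j := by
  have h1 : a i' j ≤ a i j := by
    induction i', hii using Nat.le_induction with
    | base => exact le_rfl
    | succ n hn ih => exact (ha.succ_le_left n j (hi.trans hn) hj).trans ih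
  have h2 : a i' j' ≤ a i' j := by
    induction j', hjj using Nat.le_induction with
    | base => exact le_rfl
    | succ n hn ih => exact (ha.succ_le_right i' n (hi.trans hii) (hj.trans hn)).trans ih
  exact h2.trans h1

lemma DoublyMonotone.abs_sum_sum_le {a : ℕ → ℕ → ℝ} (ha : DoublyMonotone a) (u v : ℕ → ℝ)
    (U V : ℝ) {m₁ n₁ m₂ n₂ : ℕ} (h₁ : 1 ≤ m₁) (h₂ : 1 ≤ m₂) (hmn₁ : m₁ ≤ n₁) (hmn₂ : m₂ ≤ n₂)
    (hU : ∀ j ≤ n₁, |∑ ν ∈ Finset.Ico m₁ j, u ν| ≤ U)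
    (hV : ∀ j ≤ n₂, |∑ ν ∈ Finset.Ico m₂ j, v ν| ≤ V) :
    |∑ i ∈ Finset.Ico m₁ n₁, ∑ j ∈ Finset.Ico m₂ n₂, a i j * (u i * v j)| ≤
      U * (V * a m₁ m₂) := by
  have e : ∑ i ∈ Finset.Ico m₁ n₁, ∑ j ∈ Finset.Ico m₂ n₂, a i j * (u i * v j) =
      ∑ i ∈ Finset.Ico m₁ n₁, (∑ j ∈ Finset.Ico m₂ n₂, a i j * v j) * u i := by
    refine Finset.sum_congr rfl fun i _ => ?_
    rw [Finset.sum_mul]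
    exact Finset.sum_congr rfl fun j _ => by ring
  rw [e]
  refine abs_sum_mul_le_of_majorant _ (fun i => V * a i m₂) u U m₁ n₁ hmn₁ hU ?_ ?_
  · intro i hi
    have hi1 : 1 ≤ i := h₁.trans hi
    refine abs_sum_mul_le_of_majorant (fun j => a i j) (fun j => a i j) v V m₂ n₂ hmn₂ hV ?_ ?_
    · intro j hj
      exact (abs_of_nonneg (ha.nonneg i j hi1 (h₂.trans hj))).le
    · intro j hj
      exact (abs_of_nonneg (sub_nonneg.2 (ha.succ_le_right i j hi1 (h₂.trans hj)))).le
  · intro i hi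
    have hi1 : 1 ≤ i := h₁.trans hi
    rw [← Finset.sum_sub_distrib, ← mul_sub]
    simp only [← sub_mul]
    refine abs_sum_mul_le_of_majorant (fun j => a i j - a (i + 1) j)
      (fun j => a i j - a (i + 1) j) v V m₂ n₂ hmn₂ hV ?_ ?_
    · intro j hj
      exact (abs_of_nonneg (sub_nonneg.2 (ha.succ_le_left i j hi1 (h₂.trans hj)))).le
    · intro j hj
      have := ha.mixed i j hi1 (h₂.trans hj)
      exact (abs_of_nonneg (by linarith)).le

lemma abs_sum_cos_mul_sin_le (x θ : ℝ) (m n : ℕ) (hmn : m ≤ n) :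
    |∑ ν ∈ Finset.Ico m n, cos (ν * x + θ)| * |sin (x / 2)| ≤ 1 := by
  have e : (∑ ν ∈ Finset.Ico m n, cos (ν * x + θ)) * (2 * sin (x / 2)) =
      sin (n * x + θ - x / 2) - sin (m * x + θ - x / 2) := by
    rw [← Finset.sum_Ico_sub (fun n : ℕ => sin (n * x + θ - x / 2)) hmn, Finset.sum_mul]
    refine Finset.sum_congr rfl fun ν _ => ?_
    have h : ((ν + 1 : ℕ) : ℝ) * x + θ - x / 2 = (ν * x + θ) + x / 2 := by push_cast; ring
    rw [h, sin_add, sin_sub]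
    ring
  have h2 : |∑ ν ∈ Finset.Ico m n, cos (ν * x + θ)| * |sin (x / 2)| * 2 ≤ 1 + 1 := by
    calc _ = |(∑ ν ∈ Finset.Ico m n, cos (ν * x + θ)) * (2 * sin (x / 2))| := by
          rw [abs_mul, abs_mul, abs_two]; ring
      _ ≤ 1 + 1 := by
          rw [e]
          exact (abs_sub _ _).trans (add_le_add (abs_sin_le_one _) (abs_sin_le_one _))
  linarith

/-- The normalized distance to the endpoints of the period interval. -/
def edgeDist (x : ℝ) : ℝ := min x (2 * π - x) / π

lemma edgeDist_pos {x : ℝ} (hx : x ∈ Set.Ioo 0 (2 * π)) : 0 < edgeDist x :=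
  div_pos (lt_min hx.1 (by linarith [hx.2])) pi_pos

lemma edgeDist_le_one (x : ℝ) : edgeDist x ≤ 1 := by
  rw [edgeDist, div_le_one pi_pos]
  rcases le_total x π with h | h
  · exact (min_le_left _ _).trans h
  · exact (min_le_right _ _).trans (by linarith)

lemma edgeDist_le_abs_sin {x : ℝ} (hx : x ∈ Set.Ioo 0 (2 * π)) : edgeDist x ≤ |sin (x / 2)| := by
  refine le_trans ?_ (le_abs_self _)
  rw [edgeDist]
  rcases le_total x π with h | h
  · refine le_trans ?_ (mul_le_sin (x := x / 2) (by linarith [hx.1]) (by linarith))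
    rw [div_le_iff₀ pi_pos]
    have : 2 / π * (x / 2) * π = x := by field_simp
    rw [this]; exact min_le_left _ _
  · have h1 : sin (x / 2) = sin (π - x / 2) := (sin_pi_sub _).symm
    rw [h1]
    refine le_trans ?_ (mul_le_sin (x := π - x / 2) (by linarith [hx.2]) (by linarith))
    rw [div_le_iff₀ pi_pos]
    have : 2 / π * (π - x / 2) * π = 2 * π - x := by field_simp
    rw [this]; exact min_le_right _ _

lemma measurable_edgeDist : Measurable edgeDist := by unfold edgeDist; fun_prop

/-- Sums of `ν ^ r * cos (ν x + θ)` over an index interval below `2 ^ (k + 1)`. -/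
lemma abs_sum_rpow_mul_cos_le {r : ℝ} (hr : 0 ≤ r) (θ : ℝ) {x : ℝ} (hx : x ∈ Set.Ioo 0 (2 * π))
    (k m n : ℕ) (hn : n ≤ 2 ^ (k + 1)) :
    |∑ ν ∈ Finset.Ico m n, (ν : ℝ) ^ r * cos (ν * x + θ)| ≤
      2 * 2 ^ r * (2 : ℝ) ^ (k * r) * min (2 ^ k) (1 / edgeDist x) := by
  have hs := edgeDist_pos hx
  have hpow : ∀ ν : ℕ, ν ≤ n → (ν : ℝ) ^ r ≤ 2 ^ r * (2 : ℝ) ^ (k * r) := by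
    intro ν hν
    calc (ν : ℝ) ^ r ≤ ((2 : ℝ) ^ (k + 1)) ^ r := by
          refine rpow_le_rpow (by positivity) ?_ hr
          exact_mod_cast hν.trans hn
      _ = _ := by
          rw [← rpow_natCast, ← rpow_mul (by norm_num), ← rpow_add (by norm_num)]
          push_cast; ring_nf
  rcases le_or_gt m n with hmn | hmn
  swap
  · rw [Finset.Ico_eq_empty (by omega)]; simp only [Finset.sum_empty, abs_zero]; positivity
  rw [mul_min_of_nonneg _ _ (by positivity)]
  refine le_min ?_ ?_
  · calc _ ≤ ∑ ν ∈ Finset.Ico m n, |(ν : ℝ) ^ r * cos (ν * x + θ)| := Finset.abs_sum_le_sum_abs _ _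
      _ ≤ ∑ ν ∈ Finset.Ico m n, 2 ^ r * (2 : ℝ) ^ (k * r) := by
          refine Finset.sum_le_sum fun ν hν => ?_
          rw [abs_mul, abs_of_nonneg (by positivity : (0:ℝ) ≤ (ν : ℝ) ^ r)]
          calc _ ≤ (ν : ℝ) ^ r * 1 := by gcongr; exact abs_cos_le_one _
            _ ≤ _ := by rw [mul_one]; exact hpow ν (Finset.mem_Ico.1 hν).2.le
      _ = ((n - m : ℕ) : ℝ) * (2 ^ r * (2 : ℝ) ^ (k * r)) := by simp
      _ ≤ (2 : ℝ) ^ (k + 1) * (2 ^ r * (2 : ℝ) ^ (k * r)) := by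
          gcongr
          exact_mod_cast (Nat.sub_le n m).trans hn
      _ = _ := by ring
  · have h := abs_sum_mul_le_of_variation (fun ν => (ν : ℝ) ^ r) (fun ν => cos (ν * x + θ))
      (1 / edgeDist x) m n hmn (fun j _ => by
        rcases le_or_gt m j with hj | hj
        · rw [le_div_iff₀ hs]
          exact (mul_le_mul_of_nonneg_left (edgeDist_le_abs_sin hx) (abs_nonneg _)).trans
            (abs_sum_cos_mul_sin_le x θ m j hj)
        · rw [Finset.Ico_eq_empty (by omega)]; simp only [Finset.sum_empty, abs_zero]; positivity)
    refine h.trans ?_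
    have hv : ∑ ν ∈ Finset.Ico m n, |(ν : ℝ) ^ r - ((ν + 1 : ℕ) : ℝ) ^ r| =
        (n : ℝ) ^ r - (m : ℝ) ^ r := by
      rw [← Finset.sum_Ico_sub (fun ν : ℕ => (ν : ℝ) ^ r) hmn]
      refine Finset.sum_congr rfl fun ν _ => ?_
      rw [abs_sub_comm, abs_of_nonneg]
      refine sub_nonneg.2 (rpow_le_rpow (by positivity) (by push_cast; linarith) hr)
    rw [hv, abs_of_nonneg (by positivity : (0:ℝ) ≤ (n : ℝ) ^ r), mul_comm]
    have hm0 : (0:ℝ) ≤ (m : ℝ) ^ r := by positivity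
    have := hpow n le_rfl
    refine mul_le_mul_of_nonneg_right ?_ (by positivity)
    linarith

lemma rpow_tsum_mul_le {ι : Type*} {q : ℝ} (hq : 1 < q) (w f : ι → ℝ≥0∞) :
    (∑' i, w i * f i) ^ q ≤ (∑' i, w i) ^ (q - 1) * ∑' i, w i * f i ^ q := by
  have hq0 : 0 < q := by linarith
  have h : ∑' i, w i * f i ≤ (∑' i, w i) ^ (1 - q⁻¹) * (∑' i, w i * f i ^ q) ^ q⁻¹ := by
    rw [ENNReal.tsum_eq_iSup_sum]
    refine iSup_le fun s => (ENNReal.inner_le_weight_mul_Lp_of_nonneg s hq.le w f).trans ?_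
    have : 0 ≤ 1 - q⁻¹ := sub_nonneg.2 (inv_le_one_of_one_le₀ hq.le)
    gcongr
    · exact ENNReal.sum_le_tsum s
    · exact ENNReal.sum_le_tsum s
  calc _ ≤ ((∑' i, w i) ^ (1 - q⁻¹) * (∑' i, w i * f i ^ q) ^ q⁻¹) ^ q := by gcongr
    _ = _ := by
      rw [ENNReal.mul_rpow_of_nonneg _ _ hq0.le, ← ENNReal.rpow_mul, ← ENNReal.rpow_mul,
        inv_mul_cancel₀ hq0.ne', ENNReal.rpow_one, sub_mul, inv_mul_cancel₀ hq0.ne', one_mul]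

lemma tsum_two_rpow_mul_min_le {β : ℝ} (h0 : 0 < β) (h1 : β < 1) :
    ∃ C : ℝ≥0, ∀ s : ℝ, 0 < s → s ≤ 1 →
      ∑' k : ℕ, ENNReal.ofReal ((2:ℝ) ^ (-(k * β))) * ENNReal.ofReal (min (2 ^ k) (1 / s)) ≤
        C * ENNReal.ofReal (s ^ (β - 1)) := by
  set ρ₁ : ℝ := 2 ^ (-(1 - β)) with hρ₁
  set ρ₂ : ℝ := 2 ^ (-β) with hρ₂
  have hρ₁1 : ENNReal.ofReal ρ₁ < 1 := by
    rw [ENNReal.ofReal_lt_one]; exact rpow_lt_one_of_one_lt_of_neg (by norm_num) (by linarith)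
  have hρ₂1 : ENNReal.ofReal ρ₂ < 1 := by
    rw [ENNReal.ofReal_lt_one]; exact rpow_lt_one_of_one_lt_of_neg (by norm_num) (by linarith)
  have hρ₁0 : 0 < ρ₁ := by positivity
  have hρ₂0 : 0 < ρ₂ := by positivity
  set D : ℝ≥0∞ := (1 - ENNReal.ofReal ρ₁)⁻¹ + (1 - ENNReal.ofReal ρ₂)⁻¹ with hD
  have hDtop : D ≠ ⊤ := by
    refine ENNReal.add_ne_top.2 ⟨ENNReal.inv_ne_top.2 (tsub_pos_of_lt hρ₁1).ne',
      ENNReal.inv_ne_top.2 (tsub_pos_of_lt hρ₂1).ne'⟩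
  refine ⟨D.toNNReal, fun s hs hs1 => ?_⟩
  rw [ENNReal.coe_toNNReal hDtop]
  obtain ⟨N, hN1, hN2⟩ := exists_nat_pow_near (one_le_one_div hs hs1) (one_lt_two (α := ℝ))
  have hsp : s ^ (β - 1) = (1 / s) ^ (1 - β) := by
    rw [one_div, inv_rpow hs.le, ← rpow_neg hs.le]; ring_nf
  have hsp2 : s ^ (β - 1) = (1 / s) ^ (-β) * (1 / s) := by
    rw [hsp, sub_eq_neg_add, rpow_add (by positivity), rpow_one]
  have hA : ∀ k ∈ Finset.range (N + 1),
      ENNReal.ofReal ((2:ℝ) ^ (-(k * β))) * ENNReal.ofReal (min (2 ^ k) (1 / s)) ≤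
        ENNReal.ofReal (s ^ (β - 1)) * ENNReal.ofReal ρ₁ ^ (N - k) := by
    intro k hk
    have hkN : k ≤ N := Nat.lt_succ_iff.1 (Finset.mem_range.1 hk)
    rw [← ENNReal.ofReal_mul (by positivity), ← ENNReal.ofReal_pow hρ₁0.le,
      ← ENNReal.ofReal_mul (by positivity)]
    refine ENNReal.ofReal_le_ofReal ?_
    calc (2:ℝ) ^ (-(k * β)) * min (2 ^ k) (1 / s) ≤ (2:ℝ) ^ (-(k * β)) * 2 ^ k := by
          gcongr; exact min_le_left _ _
      _ = ((2:ℝ) ^ N) ^ (1 - β) * ρ₁ ^ (N - k) := by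
          rw [hρ₁, ← rpow_natCast 2 N, ← rpow_natCast 2 k, ← rpow_natCast _ (N - k),
            ← rpow_mul (by norm_num), ← rpow_mul (by norm_num), ← rpow_add (by norm_num),
            ← rpow_add (by norm_num)]
          push_cast [Nat.cast_sub hkN]
          ring_nf
      _ ≤ (1 / s) ^ (1 - β) * ρ₁ ^ (N - k) := by
          gcongr
      _ = _ := by rw [hsp]
  have hB : ∀ j : ℕ, ENNReal.ofReal ((2:ℝ) ^ (-((j + (N + 1) : ℕ) * β))) *
      ENNReal.ofReal (min (2 ^ (j + (N + 1))) (1 / s)) ≤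
        ENNReal.ofReal (s ^ (β - 1)) * ENNReal.ofReal ρ₂ ^ j := by
    intro j
    rw [← ENNReal.ofReal_mul (by positivity), ← ENNReal.ofReal_pow hρ₂0.le,
      ← ENNReal.ofReal_mul (by positivity)]
    refine ENNReal.ofReal_le_ofReal ?_
    calc (2:ℝ) ^ (-((j + (N + 1) : ℕ) * β)) * min (2 ^ (j + (N + 1))) (1 / s)
        ≤ (2:ℝ) ^ (-((j + (N + 1) : ℕ) * β)) * (1 / s) := by
          gcongr; exact min_le_right _ _
      _ = ((2:ℝ) ^ (N + 1)) ^ (-β) * ρ₂ ^ j * (1 / s) := by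
          rw [hρ₂, ← rpow_natCast 2 (N + 1), ← rpow_natCast _ j,
            ← rpow_mul (by norm_num), ← rpow_mul (by norm_num), ← rpow_add (by norm_num)]
          push_cast
          ring_nf
      _ ≤ (1 / s) ^ (-β) * ρ₂ ^ j * (1 / s) := by
          have : ((2:ℝ) ^ (N + 1)) ^ (-β) ≤ (1 / s) ^ (-β) :=
            rpow_le_rpow_of_nonpos (by positivity) hN2.le (by linarith)
          gcongr
      _ = _ := by rw [hsp2]; ring
  rw [← ENNReal.summable.sum_add_tsum_nat_add' (k := N + 1), hD, mul_comm, mul_add]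
  refine add_le_add ?_ ?_
  · refine (Finset.sum_le_sum hA).trans ?_
    rw [← Finset.mul_sum]
    gcongr
    have := Finset.sum_range_reflect (fun j => ENNReal.ofReal ρ₁ ^ j) (N + 1)
    simp only [Nat.add_sub_cancel] at this
    rw [this, ← ENNReal.tsum_geometric]
    exact ENNReal.sum_le_tsum _
  · refine (ENNReal.tsum_le_tsum hB).trans ?_
    rw [ENNReal.tsum_mul_left, ENNReal.tsum_geometric]

lemma lintegral_Ioi_min_mul_rpow_le {γ : ℝ} (h0 : 0 < γ) (h1 : γ < 1) (k : ℕ) :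
    ∫⁻ x in Set.Ioi (0:ℝ), ENNReal.ofReal (min (2 ^ k) (1 / x) * x ^ (-γ)) ≤
      ENNReal.ofReal ((1 / (1 - γ) + 1 / γ) * 2 ^ (k * γ)) := by
  set t : ℝ := (2 ^ k)⁻¹ with ht
  have ht0 : 0 < t := by positivity
  have htp : t = 2 ^ (-(k:ℝ)) := by rw [ht, ← rpow_natCast, rpow_neg (by norm_num)]
  rw [← Set.Ioc_union_Ioi_eq_Ioi ht0.le]
  refine (lintegral_union_le _ _ _).trans ?_
  have hi1 : IntegrableOn (fun x : ℝ => 2 ^ k * x ^ (-γ)) (Set.Ioc 0 t) :=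
    ((intervalIntegrable_iff_integrableOn_Ioc_of_le ht0.le).1
      (intervalIntegral.intervalIntegrable_rpow' (by linarith))).const_mul _
  have hi2 : IntegrableOn (fun x : ℝ => x ^ (-1 - γ)) (Set.Ioi t) :=
    integrableOn_Ioi_rpow_of_lt (by linarith) ht0
  rw [add_mul, ENNReal.ofReal_add (mul_nonneg (one_div_nonneg.2 (by linarith)) (by positivity))
    (by positivity)]
  refine add_le_add ?_ ?_
  · calc _ ≤ ∫⁻ x in Set.Ioc 0 t, ENNReal.ofReal (2 ^ k * x ^ (-γ)) := by
          refine setLIntegral_mono' measurableSet_Ioc fun x hx => ENNReal.ofReal_le_ofReal ?_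
          have : 0 ≤ x ^ (-γ) := rpow_nonneg hx.1.le _
          gcongr
          exact min_le_left _ _
      _ = ENNReal.ofReal (∫ x in Set.Ioc 0 t, 2 ^ k * x ^ (-γ)) := by
          rw [ofReal_integral_eq_lintegral_ofReal hi1]
          refine (ae_restrict_iff' measurableSet_Ioc).2 (Filter.Eventually.of_forall fun x hx => ?_)
          exact mul_nonneg (by positivity) (rpow_nonneg hx.1.le _)
      _ ≤ _ := by
          refine ENNReal.ofReal_le_ofReal (le_of_eq ?_)
          rw [← intervalIntegral.integral_of_le ht0.le, intervalIntegral.integral_const_mul,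
            integral_rpow (Or.inl (by linarith)), zero_rpow (by linarith), htp,
            ← rpow_mul (by norm_num), ← rpow_natCast, sub_zero, mul_div_assoc', ←
            rpow_add (by norm_num)]
          rw [div_mul_eq_mul_div, one_mul]
          have e2 : -γ + 1 = 1 - γ := by ring
          rw [e2]
          congr 2; ring
  · calc _ ≤ ∫⁻ x in Set.Ioi t, ENNReal.ofReal (x ^ (-1 - γ)) := by
          refine setLIntegral_mono' measurableSet_Ioi fun x hx => ENNReal.ofReal_le_ofReal ?_
          have hx0 : 0 < x := ht0.trans hx
          rw [sub_eq_add_neg, rpow_add hx0, rpow_neg_one, ← one_div]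
          have : 0 ≤ x ^ (-γ) := rpow_nonneg hx0.le _
          gcongr
          exact min_le_right _ _
      _ = ENNReal.ofReal (∫ x in Set.Ioi t, x ^ (-1 - γ)) := by
          rw [ofReal_integral_eq_lintegral_ofReal hi2]
          refine (ae_restrict_iff' measurableSet_Ioi).2 (Filter.Eventually.of_forall fun x hx => ?_)
          exact rpow_nonneg (ht0.trans hx).le _
      _ ≤ _ := by
          refine ENNReal.ofReal_le_ofReal (le_of_eq ?_)
          rw [integral_Ioi_rpow_of_lt (by linarith) ht0, htp, ← rpow_mul (by norm_num)]
          have e1 : -1 - γ + 1 = -γ := by ring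
          rw [e1, neg_div_neg_eq, neg_mul_neg, div_mul_eq_mul_div, one_mul]

lemma lintegral_min_mul_edgeDist_rpow_le {γ : ℝ} (h0 : 0 < γ) (h1 : γ < 1) :
    ∃ C : ℝ≥0, ∀ k : ℕ, ∫⁻ x in Set.Ioc (0:ℝ) (2 * π),
      ENNReal.ofReal (min (2 ^ k) (1 / edgeDist x)) * ENNReal.ofReal (edgeDist x ^ (-γ)) ≤
        C * ENNReal.ofReal (2 ^ (k * γ)) := by
  set F : ℕ → ℝ → ℝ≥0∞ := fun k x => ENNReal.ofReal (min (2 ^ k) (1 / x) * x ^ (-γ)) with hF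
  have hFm : ∀ k, Measurable (F k) := fun k => by simp only [hF]; fun_prop
  have hscale : ∀ k x, 0 < x → F k (x / π) ≤ ENNReal.ofReal (π * π) * F k x := by
    intro k x hx
    have hpi : 1 ≤ π := by linarith [two_le_pi]
    simp only [hF]
    rw [← ENNReal.ofReal_mul (by positivity)]
    refine ENNReal.ofReal_le_ofReal ?_
    have e1 : min (2 ^ k) (1 / (x / π)) ≤ π * min (2 ^ k) (1 / x) := by
      rw [mul_min_of_nonneg _ _ pi_pos.le]
      refine min_le_min ?_ (le_of_eq (by field_simp))
      exact le_mul_of_one_le_left (by positivity) hpi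
    have e2 : (x / π) ^ (-γ) ≤ π * x ^ (-γ) := by
      rw [div_rpow hx.le pi_pos.le, rpow_neg pi_pos.le, div_inv_eq_mul, mul_comm]
      have : π ^ γ ≤ π := by
        calc π ^ γ ≤ π ^ (1:ℝ) := rpow_le_rpow_of_exponent_le hpi h1.le
          _ = π := rpow_one _
      gcongr
    calc _ ≤ (π * min (2 ^ k) (1 / x)) * (π * x ^ (-γ)) := by gcongr
      _ = _ := by ring
  refine ⟨(2 * (ENNReal.ofReal (π * π) * ENNReal.ofReal (1 / (1 - γ) + 1 / γ))).toNNReal,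
    fun k => ?_⟩
  rw [ENNReal.coe_toNNReal (by finiteness)]
  have hle : ∫⁻ x in Set.Ioo (0:ℝ) (2 * π), F k (x / π) ≤
      ENNReal.ofReal (π * π) * ENNReal.ofReal ((1 / (1 - γ) + 1 / γ) * 2 ^ (k * γ)) := by
    calc _ ≤ ∫⁻ x in Set.Ioo (0:ℝ) (2 * π), ENNReal.ofReal (π * π) * F k x :=
          setLIntegral_mono' measurableSet_Ioo fun x hx => hscale k x hx.1
      _ ≤ ∫⁻ x in Set.Ioi (0:ℝ), ENNReal.ofReal (π * π) * F k x :=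
          lintegral_mono_set Set.Ioo_subset_Ioi_self
      _ = ENNReal.ofReal (π * π) * ∫⁻ x in Set.Ioi (0:ℝ), F k x :=
          lintegral_const_mul _ (hFm k)
      _ ≤ _ := by gcongr; exact lintegral_Ioi_min_mul_rpow_le h0 h1 k
  have hrefl : ∫⁻ x in Set.Ioo (0:ℝ) (2 * π), F k ((2 * π - x) / π) =
      ∫⁻ x in Set.Ioo (0:ℝ) (2 * π), F k (x / π) := by
    have h := (Measure.measurePreserving_sub_left
      (volume : Measure ℝ) (2 * π)).setLIntegral_comp_preimage
      (measurableSet_Ioo (a := (0:ℝ)) (b := 2 * π)) (f := fun x => F k (x / π))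
      ((hFm k).comp (by fun_prop))
    rw [← h]
    simp
  rw [setLIntegral_congr Ioo_ae_eq_Ioc.symm]
  calc _ ≤ ∫⁻ x in Set.Ioo (0:ℝ) (2 * π), (F k (x / π) + F k ((2 * π - x) / π)) := by
        refine setLIntegral_mono' measurableSet_Ioo fun x hx => ?_
        have hs := edgeDist_pos hx
        rw [← ENNReal.ofReal_mul (by positivity)]
        change F k (edgeDist x) ≤ _
        rw [edgeDist]
        rcases min_choice x (2 * π - x) with h | h <;> rw [h]
        · exact le_self_add
        · exact le_add_self
    _ = (∫⁻ x in Set.Ioo (0:ℝ) (2 * π), F k (x / π)) +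
          ∫⁻ x in Set.Ioo (0:ℝ) (2 * π), F k ((2 * π - x) / π) :=
        lintegral_add_left ((hFm k).comp (by fun_prop)) _
    _ ≤ 2 * (ENNReal.ofReal (π * π) * ENNReal.ofReal ((1 / (1 - γ) + 1 / γ) * 2 ^ (k * γ))) := by
        rw [hrefl, ← two_mul]; gcongr
    _ = _ := by
        rw [ENNReal.ofReal_mul (p := 1 / (1 - γ) + 1 / γ)]
        · ring
        · exact add_nonneg (one_div_nonneg.2 (by linarith)) (by positivity)

/-- Lebesgue measure on the period interval. -/
def periodMeasure : Measure ℝ := volume.restrict (Set.Ioc (0:ℝ) (2 * π))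

instance : IsFiniteMeasure periodMeasure := by unfold periodMeasure; infer_instance

lemma ae_periodMeasure_mem_Ioo : ∀ᵐ x ∂periodMeasure, x ∈ Set.Ioo (0:ℝ) (2 * π) := by
  rw [periodMeasure, Measure.restrict_congr_set Ioo_ae_eq_Ioc.symm]
  exact ae_restrict_mem measurableSet_Ioo

lemma ae_prod_mem_Ioo : ∀ᵐ z ∂(periodMeasure.prod periodMeasure),
    z.1 ∈ Set.Ioo (0:ℝ) (2 * π) ∧ z.2 ∈ Set.Ioo (0:ℝ) (2 * π) := by
  have h1 := Measure.quasiMeasurePreserving_fst (μ := periodMeasure) (ν := periodMeasure)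
    |>.ae ae_periodMeasure_mem_Ioo
  have h2 := Measure.quasiMeasurePreserving_snd (μ := periodMeasure) (ν := periodMeasure)
    |>.ae ae_periodMeasure_mem_Ioo
  filter_upwards [h1, h2] with z hz1 hz2 using ⟨hz1, hz2⟩

/-- The common majorant of block kernels at scale `2 ^ k`. -/
def blockMajorant (k : ℕ) (x : ℝ) : ℝ≥0∞ := ENNReal.ofReal (min (2 ^ k) (1 / edgeDist x))

lemma measurable_blockMajorant (k : ℕ) : Measurable (blockMajorant k) := by
  have := measurable_edgeDist
  unfold blockMajorant; fun_prop

/-- `L_q` bound for superpositions of tensor products of block kernels. -/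
lemma lintegral_tsum_blockMajorant_rpow_le {q : ℝ} (hq : 1 < q) :
    ∃ C : ℝ≥0, ∀ c : ℕ × ℕ → ℝ≥0∞,
      ∫⁻ z, (∑' i : ℕ × ℕ, c i * (blockMajorant i.1 z.1 * blockMajorant i.2 z.2)) ^ q
          ∂(periodMeasure.prod periodMeasure) ≤
        C * ∑' i : ℕ × ℕ, c i ^ q *
          (ENNReal.ofReal (2 ^ (i.1 * (q - 1))) * ENNReal.ofReal (2 ^ (i.2 * (q - 1)))) := by
  have hq0 : 0 < q := by linarith
  set β : ℝ := 1 - 1 / (2 * q) with hβ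
  set γ : ℝ := (1 - β) * (q - 1) with hγ
  have hb : 1 / (2 * q) < 1 := by rw [div_lt_one (by linarith)]; linarith
  have hβ0 : 0 < β := by linarith
  have hβ1 : β < 1 := by have : 0 < 1 / (2 * q) := by positivity
                         linarith
  have hγe : γ = (q - 1) / (2 * q) := by rw [hγ, hβ]; field_simp; ring
  have hγ0 : 0 < γ := mul_pos (by linarith) (by linarith)
  have hγ1 : γ < 1 := by rw [hγe, div_lt_one (by linarith)]; linarith
  obtain ⟨C₁, hC₁⟩ := tsum_two_rpow_mul_min_le hβ0 hβ1
  obtain ⟨C₂, hC₂⟩ := lintegral_min_mul_edgeDist_rpow_le hγ0 hγ1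
  refine ⟨(C₁ ^ (q - 1)) ^ 2 * C₂ ^ 2, fun c => ?_⟩
  set w : ℕ → ℝ≥0∞ := fun k => ENNReal.ofReal ((2:ℝ) ^ (-(k * β))) with hw
  set v : ℕ → ℝ≥0∞ := fun k => ENNReal.ofReal ((2:ℝ) ^ (k * β)) with hv
  have hwv : ∀ k, w k * v k = 1 := by
    intro k
    simp only [hw, hv]
    rw [← ENNReal.ofReal_mul (by positivity), ← rpow_add (by norm_num)]
    simp
  have hwv' : ∀ k, w k * v k ^ q * ENNReal.ofReal (2 ^ (k * γ)) =
      ENNReal.ofReal (2 ^ (k * (q - 1))) := by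
    intro k
    simp only [hw, hv]
    rw [ENNReal.ofReal_rpow_of_pos (by positivity), ← ENNReal.ofReal_mul (by positivity),
      ← ENNReal.ofReal_mul (by positivity), ← rpow_mul (by norm_num), ← rpow_add (by norm_num),
      ← rpow_add (by norm_num), hγ]
    congr 2; ring
  set S : ℝ → ℝ≥0∞ := fun x => ENNReal.ofReal (edgeDist x ^ (-γ)) with hS
  have hSm : Measurable S := by have := measurable_edgeDist; simp only [hS]; fun_prop
  have hsum : ∀ x ∈ Set.Ioo (0:ℝ) (2 * π),
      (∑' k, w k * blockMajorant k x) ^ (q - 1) ≤ C₁ ^ (q - 1) * S x := by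
    intro x hx
    have hs := edgeDist_pos hx
    calc _ ≤ ((C₁:ℝ≥0∞) * ENNReal.ofReal (edgeDist x ^ (β - 1))) ^ (q - 1) := by
          gcongr
          exact hC₁ _ hs (edgeDist_le_one x)
      _ = _ := by
          rw [ENNReal.mul_rpow_of_nonneg _ _ (by linarith),
            ENNReal.ofReal_rpow_of_pos (by positivity), ← rpow_mul hs.le, hS]
          congr 3
          rw [hγ]; ring
  have hpt : ∀ z : ℝ × ℝ, z.1 ∈ Set.Ioo (0:ℝ) (2 * π) ∧ z.2 ∈ Set.Ioo (0:ℝ) (2 * π) →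
      (∑' i : ℕ × ℕ, c i * (blockMajorant i.1 z.1 * blockMajorant i.2 z.2)) ^ q ≤
      ∑' i : ℕ × ℕ, ((C₁:ℝ≥0∞) ^ (q - 1)) ^ 2 * (c i ^ q * (w i.1 * v i.1 ^ q) *
        (w i.2 * v i.2 ^ q)) *
        ((blockMajorant i.1 z.1 * S z.1) * (blockMajorant i.2 z.2 * S z.2)) := by
    rintro ⟨x, y⟩ ⟨hx, hy⟩
    have e := rpow_tsum_mul_le hq
      (fun i : ℕ × ℕ => (w i.1 * blockMajorant i.1 x) * (w i.2 * blockMajorant i.2 y))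
      (fun i => c i * (v i.1 * v i.2))
    have e1 : ∀ i : ℕ × ℕ, (w i.1 * blockMajorant i.1 x) * (w i.2 * blockMajorant i.2 y) *
        (c i * (v i.1 * v i.2)) = c i * (blockMajorant i.1 x * blockMajorant i.2 y) := by
      intro i
      calc _ = c i * (blockMajorant i.1 x * blockMajorant i.2 y) * (w i.1 * v i.1) *
            (w i.2 * v i.2) := by ring
        _ = _ := by rw [hwv, hwv, mul_one, mul_one]
    simp only [e1] at e
    refine e.trans ?_
    rw [ENNReal.tsum_prod' (f := fun i : ℕ × ℕ =>
      (w i.1 * blockMajorant i.1 x) * (w i.2 * blockMajorant i.2 y))]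
    simp only [ENNReal.tsum_mul_left, ENNReal.tsum_mul_right]
    rw [ENNReal.mul_rpow_of_nonneg _ _ (by linarith)]
    calc _ ≤ (C₁ ^ (q - 1) * S x) * (C₁ ^ (q - 1) * S y) *
          ∑' i : ℕ × ℕ, (w i.1 * blockMajorant i.1 x) * (w i.2 * blockMajorant i.2 y) *
            (c i * (v i.1 * v i.2)) ^ q := by
          gcongr
          · exact hsum x hx
          · exact hsum y hy
      _ = _ := by
          rw [← ENNReal.tsum_mul_left]
          refine tsum_congr fun i => ?_
          rw [ENNReal.mul_rpow_of_nonneg _ _ hq0.le, ENNReal.mul_rpow_of_nonneg _ _ hq0.le]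
          ring
  have hm : ∀ k, Measurable fun x => blockMajorant k x * S x :=
    fun k => (measurable_blockMajorant k).mul hSm
  calc _ ≤ ∫⁻ z, ∑' i : ℕ × ℕ, ((C₁:ℝ≥0∞) ^ (q - 1)) ^ 2 * (c i ^ q * (w i.1 * v i.1 ^ q) *
        (w i.2 * v i.2 ^ q)) *
        ((blockMajorant i.1 z.1 * S z.1) * (blockMajorant i.2 z.2 * S z.2))
          ∂(periodMeasure.prod periodMeasure) :=
        lintegral_mono_ae (ae_prod_mem_Ioo.mono hpt)
    _ = ∑' i : ℕ × ℕ, ((C₁:ℝ≥0∞) ^ (q - 1)) ^ 2 * (c i ^ q * (w i.1 * v i.1 ^ q) *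
        (w i.2 * v i.2 ^ q)) * ((∫⁻ x, blockMajorant i.1 x * S x ∂periodMeasure) *
          (∫⁻ x, blockMajorant i.2 x * S x ∂periodMeasure)) := by
        have hm2 : ∀ i : ℕ × ℕ, Measurable fun z : ℝ × ℝ =>
            (blockMajorant i.1 z.1 * S z.1) * (blockMajorant i.2 z.2 * S z.2) := fun i =>
          ((hm i.1).comp measurable_fst).mul ((hm i.2).comp measurable_snd)
        rw [lintegral_tsum fun i => ((hm2 i).const_mul _).aemeasurable]
        refine tsum_congr fun i => ?_
        rw [lintegral_const_mul _ (hm2 i), lintegral_prod_mul (hm i.1).aemeasurable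
          (hm i.2).aemeasurable]
    _ ≤ ∑' i : ℕ × ℕ, ((C₁:ℝ≥0∞) ^ (q - 1)) ^ 2 * (c i ^ q * (w i.1 * v i.1 ^ q) *
        (w i.2 * v i.2 ^ q)) * ((C₂ * ENNReal.ofReal (2 ^ (i.1 * γ))) *
          (C₂ * ENNReal.ofReal (2 ^ (i.2 * γ)))) := by
        gcongr with i
        · exact hC₂ i.1
        · exact hC₂ i.2
    _ = _ := by
        rw [← ENNReal.tsum_mul_left]
        refine tsum_congr fun i => ?_
        rw [← hwv' i.1, ← hwv' i.2]
        push_cast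
        rw [ENNReal.coe_rpow_of_nonneg _ (by linarith)]
        ring

/-- The dyadic block of indices `2 ^ k ≤ ν < 2 ^ (k + 1)`. -/
def blockIco (k : ℕ) : Finset ℕ := Finset.Ico (2 ^ k) (2 ^ (k + 1))

/-- The dyadic block of indices `2 ^ k / 2 < ν ≤ 2 ^ k`. -/
def blockIoc (k : ℕ) : Finset ℕ := Finset.Ioc (2 ^ k / 2) (2 ^ k)

lemma one_le_of_mem_blockIco {k ν : ℕ} (h : ν ∈ blockIco k) : 1 ≤ ν :=
  Nat.one_le_two_pow.trans (Finset.mem_Ico.1 h).1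

lemma one_le_of_mem_blockIoc {k ν : ℕ} (h : ν ∈ blockIoc k) : 1 ≤ ν := by
  exact Nat.one_le_iff_ne_zero.2 (Nat.ne_zero_of_lt (Finset.mem_Ioc.1 h).1)

lemma eq_of_mem_blockIoc {k l ν : ℕ} (hk : ν ∈ blockIoc k) (hl : ν ∈ blockIoc l) : k = l := by
  wlog h : k < l generalizing k l
  · rcases lt_trichotomy k l with h1 | h1 | h1
    · exact absurd h1 h
    · exact h1
    · exact (this hl hk h1).symm
  have h1 := Finset.mem_Ioc.1 hk
  have h2 := Finset.mem_Ioc.1 hl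
  have h3 : 2 ^ (k + 1) ≤ 2 ^ l := Nat.pow_le_pow_right (by norm_num) h
  have h4 : 2 ^ (k + 1) = 2 * 2 ^ k := by ring
  omega

lemma mem_blockIco_iff {k ν : ℕ} (hν : 1 ≤ ν) : ν ∈ blockIco k ↔ k = Nat.log 2 ν := by
  rw [blockIco, Finset.mem_Ico, eq_comm, Nat.log_eq_iff (Or.inr ⟨by norm_num, by omega⟩)]

lemma tsum_sum_blockIoc_le (G : ℕ → ℝ≥0∞) :
    ∑' k, ∑ ν ∈ blockIoc k, G ν ≤ ∑' ν, G (ν + 1) := by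
  have e : ∑' k, ∑ ν ∈ blockIoc k, G ν =
      ∑' s : (Σ k, {ν // ν ∈ blockIoc k}), G ((s.2 - 1 : ℕ) + 1) := by
    rw [ENNReal.tsum_sigma' (fun s : (Σ k, {ν // ν ∈ blockIoc k}) => G ((s.2 - 1 : ℕ) + 1))]
    refine tsum_congr fun k => ?_
    rw [← Finset.tsum_subtype (blockIoc k) G]
    refine tsum_congr fun ν => ?_
    have := one_le_of_mem_blockIoc ν.2
    rw [Nat.sub_add_cancel this]
  rw [e]
  refine ENNReal.tsum_comp_le_tsum_of_injective
    (f := fun s : (Σ k, {ν // ν ∈ blockIoc k}) => (s.2 - 1 : ℕ)) ?_ (fun ν => G (ν + 1))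
  rintro ⟨k, ν, hν⟩ ⟨l, μ, hμ⟩ h
  have h1 := one_le_of_mem_blockIoc hν
  have h2 := one_le_of_mem_blockIoc hμ
  simp only at h
  obtain rfl : ν = μ := by omega
  obtain rfl := eq_of_mem_blockIoc hν hμ
  rfl

lemma tsum_le_tsum_sum_blockIco (G : ℕ → ℝ≥0∞) :
    ∑' ν, G (ν + 1) ≤ ∑' k, ∑ ν ∈ blockIco k, G ν := by
  have e : ∑' k, ∑ ν ∈ blockIco k, G ν = ∑' s : (Σ k, {ν // ν ∈ blockIco k}), G s.2 := by
    rw [ENNReal.tsum_sigma' (fun s : (Σ k, {ν // ν ∈ blockIco k}) => G s.2)]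
    exact tsum_congr fun k => (Finset.tsum_subtype (blockIco k) G).symm
  rw [e]
  refine ENNReal.tsum_comp_le_tsum_of_injective
    (f := fun ν : ℕ => (⟨Nat.log 2 (ν + 1), ν + 1, (mem_blockIco_iff (by omega)).2 rfl⟩ :
      (Σ k, {ν // ν ∈ blockIco k}))) ?_ (fun s => G s.2)
  intro ν μ h
  have : ((⟨Nat.log 2 (ν + 1), ν + 1, (mem_blockIco_iff (by omega)).2 rfl⟩ :
      (Σ k, {ν // ν ∈ blockIco k})).2 : ℕ) = ((⟨Nat.log 2 (μ + 1), μ + 1,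
        (mem_blockIco_iff (by omega)).2 rfl⟩ : (Σ k, {ν // ν ∈ blockIco k})).2 : ℕ) :=
    congrArg (fun s : (Σ k, {ν // ν ∈ blockIco k}) => (s.2 : ℕ)) h
  simpa using this

lemma tsum_tsum_sum_comm (J : ℕ → Finset ℕ) (F : ℕ → ℕ → ℝ≥0∞) :
    ∑' i : ℕ × ℕ, ∑ μ ∈ J i.1, ∑ ν ∈ J i.2, F μ ν =
      ∑' k, ∑ μ ∈ J k, ∑' l, ∑ ν ∈ J l, F μ ν := by
  rw [ENNReal.tsum_prod' (f := fun i : ℕ × ℕ => ∑ μ ∈ J i.1, ∑ ν ∈ J i.2, F μ ν)]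
  refine tsum_congr fun k => ?_
  exact Summable.tsum_finsetSum (s := J k) (f := fun μ l => ∑ ν ∈ J l, F μ ν)
    fun _ _ => ENNReal.summable

lemma tsum_prod_sum_blockIoc_le (F : ℕ → ℕ → ℝ≥0∞) :
    ∑' i : ℕ × ℕ, ∑ μ ∈ blockIoc i.1, ∑ ν ∈ blockIoc i.2, F μ ν ≤
      ∑' (μ : ℕ) (ν : ℕ), F (μ + 1) (ν + 1) := by
  rw [tsum_tsum_sum_comm]
  exact (tsum_sum_blockIoc_le _).trans (ENNReal.tsum_le_tsum fun μ => tsum_sum_blockIoc_le _)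

lemma tsum_tsum_le_tsum_prod_sum_blockIco (F : ℕ → ℕ → ℝ≥0∞) :
    ∑' (μ : ℕ) (ν : ℕ), F (μ + 1) (ν + 1) ≤
      ∑' i : ℕ × ℕ, ∑ μ ∈ blockIco i.1, ∑ ν ∈ blockIco i.2, F μ ν := by
  rw [tsum_tsum_sum_comm]
  exact (ENNReal.tsum_le_tsum fun μ => tsum_le_tsum_sum_blockIco _).trans
    (tsum_le_tsum_sum_blockIco fun μ => ∑' l, ∑ ν ∈ blockIco l, F μ ν)

/-- Comparison of powers of numbers within a factor two of each other. -/
lemma rpow_le_two_rpow_abs_mul {x y : ℝ} (hx : 0 < x) (hy : 0 < y) (hxy : x ≤ 2 * y)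
    (hyx : y ≤ 2 * x) (e : ℝ) : x ^ e ≤ 2 ^ |e| * y ^ e := by
  rcases le_total 0 e with he | he
  · rw [abs_of_nonneg he, ← mul_rpow (by norm_num) hy.le]
    exact rpow_le_rpow hx.le hxy he
  · rw [abs_of_nonpos he]
    have h : (2 * x) ^ e ≤ y ^ e := rpow_le_rpow_of_nonpos hy hyx he
    rw [mul_rpow (by norm_num) hx.le] at h
    calc x ^ e = 2 ^ (-e) * (2 ^ e * x ^ e) := by
          rw [← mul_assoc, ← rpow_add (by norm_num), neg_add_cancel, rpow_zero, one_mul]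
      _ ≤ _ := by gcongr

lemma two_rpow_le_sum_blockIoc (e : ℝ) (k : ℕ) :
    (2:ℝ) ^ (k * (e + 1)) ≤ 2 ^ (1 + |e|) * ∑ ν ∈ blockIoc k, (ν : ℝ) ^ e := by
  have h : ∀ ν ∈ blockIoc k, (2:ℝ) ^ (-|e|) * ((2:ℝ) ^ k) ^ e ≤ (ν : ℝ) ^ e := by
    intro ν hν
    have h1 := one_le_of_mem_blockIoc hν
    obtain ⟨h2, h3⟩ := Finset.mem_Ioc.1 hν
    have h4 : 2 ^ k ≤ 2 * ν := by omega
    have := rpow_le_two_rpow_abs_mul (x := (2:ℝ) ^ k) (y := ν) (by positivity)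
      (by exact_mod_cast h1) (by exact_mod_cast h4) (by exact_mod_cast (by omega : ν ≤ 2 * 2 ^ k)) e
    rw [rpow_neg (by norm_num), inv_mul_le_iff₀ (by positivity)]
    exact this
  have hc : (2:ℝ) ^ k / 2 ≤ (blockIoc k).card := by
    rw [blockIoc, Nat.card_Ioc]
    have : 2 ^ k ≤ 2 * (2 ^ k - 2 ^ k / 2) := by omega
    have : (2:ℝ) ^ k ≤ 2 * ((2 ^ k - 2 ^ k / 2 : ℕ) : ℝ) := by exact_mod_cast this
    linarith
  calc (2:ℝ) ^ (k * (e + 1)) = 2 ^ (1 + |e|) * ((2:ℝ) ^ k / 2 *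
        ((2:ℝ) ^ (-|e|) * ((2:ℝ) ^ k) ^ e)) := by
        rw [← rpow_natCast, ← rpow_mul (by norm_num), mul_add, rpow_add (by norm_num) (k * e),
          rpow_add (by norm_num) 1, rpow_neg (by norm_num), rpow_one, mul_one]
        field_simp
    _ ≤ 2 ^ (1 + |e|) * ((blockIoc k).card * ((2:ℝ) ^ (-|e|) * ((2:ℝ) ^ k) ^ e)) := by gcongr
    _ = 2 ^ (1 + |e|) * ∑ ν ∈ blockIoc k, ((2:ℝ) ^ (-|e|) * ((2:ℝ) ^ k) ^ e) := by
        rw [Finset.sum_const, nsmul_eq_mul]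
    _ ≤ _ := by gcongr with ν hν; exact h ν hν

lemma sum_blockIco_rpow_le (e : ℝ) (k : ℕ) :
    ∑ ν ∈ blockIco k, (ν : ℝ) ^ e ≤ 2 ^ |e| * (2:ℝ) ^ (k * (e + 1)) := by
  have h : ∀ ν ∈ blockIco k, (ν : ℝ) ^ e ≤ 2 ^ |e| * ((2:ℝ) ^ k) ^ e := by
    intro ν hν
    have h1 := one_le_of_mem_blockIco hν
    obtain ⟨h2, h3⟩ := Finset.mem_Ico.1 hν
    rw [pow_succ] at h3
    exact rpow_le_two_rpow_abs_mul (by exact_mod_cast h1) (by positivity)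
      (by exact_mod_cast (by omega : ν ≤ 2 * 2 ^ k))
      (by exact_mod_cast (by omega : 2 ^ k ≤ 2 * ν)) e
  have hc : ((blockIco k).card : ℝ) = 2 ^ k := by
    rw [blockIco, Nat.card_Ico, pow_succ]
    have : 2 ^ k * 2 - 2 ^ k = 2 ^ k := by omega
    rw [this]; push_cast; rfl
  refine (Finset.sum_le_sum h).trans (le_of_eq ?_)
  rw [Finset.sum_const, nsmul_eq_mul, hc, ← rpow_natCast, ← rpow_mul (by norm_num), mul_add,
    rpow_add (by norm_num) (k * e), mul_one]
  ring

/-- The weight of the dyadic corner `(2 ^ k, 2 ^ l)` in the condensed Hardy–Littlewood sum. -/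
def cornerTerm (a : ℕ → ℕ → ℝ) (p r₁ r₂ : ℝ) (i : ℕ × ℕ) : ℝ :=
  a (2 ^ i.1) (2 ^ i.2) ^ p * ((2:ℝ) ^ (i.1 * (r₁ * p + p - 1)) * (2:ℝ) ^ (i.2 * (r₂ * p + p - 1)))

lemma DoublyMonotone.corner_nonneg {a : ℕ → ℕ → ℝ} (ha : DoublyMonotone a) (i : ℕ × ℕ) :
    0 ≤ a (2 ^ i.1) (2 ^ i.2) := ha.nonneg _ _ Nat.one_le_two_pow Nat.one_le_two_pow

lemma DoublyMonotone.cornerTerm_nonneg {a : ℕ → ℕ → ℝ} (ha : DoublyMonotone a) (p r₁ r₂ : ℝ)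
    (i : ℕ × ℕ) : 0 ≤ cornerTerm a p r₁ r₂ i := by
  have := rpow_nonneg (ha.corner_nonneg i) p
  unfold cornerTerm; positivity

/-- The Hardy–Littlewood sum before taking the `p`-th root. -/
def hardyLittlewoodSum (a : ℕ → ℕ → ℝ) (p r₁ r₂ : ℝ) : ℝ≥0∞ :=
  ∑' (ν₁ : ℕ) (ν₂ : ℕ), ENNReal.ofReal
    (a (ν₁+1) (ν₂+1) ^ p * ((ν₁+1 : ℕ) : ℝ) ^ (r₁*p+p-2) * ((ν₂+1 : ℕ) : ℝ) ^ (r₂*p+p-2))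

lemma tsum_cornerTerm_le (p r₁ r₂ : ℝ) (hp : 0 ≤ p) : ∃ C : ℝ≥0, ∀ a, DoublyMonotone a →
    ∑' i, ENNReal.ofReal (cornerTerm a p r₁ r₂ i) ≤ C * hardyLittlewoodSum a p r₁ r₂ := by
  set e₁ := r₁ * p + p - 2 with he₁
  set e₂ := r₂ * p + p - 2 with he₂
  set D : ℝ := 2 ^ (1 + |e₁|) * 2 ^ (1 + |e₂|) with hD
  have hD0 : 0 ≤ D := by positivity
  refine ⟨D.toNNReal, fun a ha => ?_⟩
  set F : ℕ → ℕ → ℝ≥0∞ := fun μ ν => ENNReal.ofReal (a μ ν ^ p * (μ:ℝ) ^ e₁ * (ν:ℝ) ^ e₂)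
  have h : ∀ i : ℕ × ℕ, ENNReal.ofReal (cornerTerm a p r₁ r₂ i) ≤
      ENNReal.ofReal D * ∑ μ ∈ blockIoc i.1, ∑ ν ∈ blockIoc i.2, F μ ν := by
    intro i
    have hnn : ∀ μ ∈ blockIoc i.1, ∀ ν ∈ blockIoc i.2, 0 ≤ a μ ν ^ p * (μ:ℝ) ^ e₁ * (ν:ℝ) ^ e₂ := by
      intro μ hμ ν hν
      have := rpow_nonneg (ha.nonneg μ ν (one_le_of_mem_blockIoc hμ) (one_le_of_mem_blockIoc hν)) p
      positivity
    have e : ∑ μ ∈ blockIoc i.1, ∑ ν ∈ blockIoc i.2, F μ ν = ENNReal.ofReal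
        (∑ μ ∈ blockIoc i.1, ∑ ν ∈ blockIoc i.2, a μ ν ^ p * (μ:ℝ) ^ e₁ * (ν:ℝ) ^ e₂) := by
      rw [ENNReal.ofReal_sum_of_nonneg fun μ hμ => Finset.sum_nonneg (hnn μ hμ)]
      exact Finset.sum_congr rfl fun μ hμ => (ENNReal.ofReal_sum_of_nonneg (hnn μ hμ)).symm
    rw [e, ← ENNReal.ofReal_mul hD0]
    refine ENNReal.ofReal_le_ofReal ?_
    have hcn := rpow_nonneg (ha.corner_nonneg i) p
    have s₁ := two_rpow_le_sum_blockIoc e₁ i.1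
    have s₂ := two_rpow_le_sum_blockIoc e₂ i.2
    have t₁ : r₁ * p + p - 1 = e₁ + 1 := by rw [he₁]; ring
    have t₂ : r₂ * p + p - 1 = e₂ + 1 := by rw [he₂]; ring
    rw [cornerTerm, t₁, t₂]
    calc _ ≤ a (2 ^ i.1) (2 ^ i.2) ^ p * ((2 ^ (1 + |e₁|) * ∑ ν ∈ blockIoc i.1, (ν : ℝ) ^ e₁) *
          (2 ^ (1 + |e₂|) * ∑ ν ∈ blockIoc i.2, (ν : ℝ) ^ e₂)) := by gcongr
      _ = D * ∑ μ ∈ blockIoc i.1, ∑ ν ∈ blockIoc i.2,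
            a (2 ^ i.1) (2 ^ i.2) ^ p * (μ:ℝ) ^ e₁ * (ν:ℝ) ^ e₂ := by
          simp only [← Finset.mul_sum, mul_assoc, ← Finset.sum_mul]
          rw [hD]; ring
      _ ≤ _ := by
          gcongr with μ hμ ν hν
          · exact ha.corner_nonneg i
          · exact ha.anti (one_le_of_mem_blockIoc hμ) (one_le_of_mem_blockIoc hν)
              (Finset.mem_Ioc.1 hμ).2 (Finset.mem_Ioc.1 hν).2
  refine (ENNReal.tsum_le_tsum h).trans ?_
  rw [ENNReal.tsum_mul_left]
  exact mul_le_mul_right (tsum_prod_sum_blockIoc_le F) _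

lemma hardyLittlewoodSum_le (p r₁ r₂ : ℝ) (hp : 0 ≤ p) : ∃ C : ℝ≥0, ∀ a, DoublyMonotone a →
    hardyLittlewoodSum a p r₁ r₂ ≤ C * ∑' i, ENNReal.ofReal (cornerTerm a p r₁ r₂ i) := by
  set e₁ := r₁ * p + p - 2 with he₁
  set e₂ := r₂ * p + p - 2 with he₂
  set D : ℝ := 2 ^ |e₁| * 2 ^ |e₂| with hD
  have hD0 : 0 ≤ D := by positivity
  refine ⟨D.toNNReal, fun a ha => ?_⟩
  set F : ℕ → ℕ → ℝ≥0∞ := fun μ ν => ENNReal.ofReal (a μ ν ^ p * (μ:ℝ) ^ e₁ * (ν:ℝ) ^ e₂)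
  have h : ∀ i : ℕ × ℕ, ∑ μ ∈ blockIco i.1, ∑ ν ∈ blockIco i.2, F μ ν ≤
      ENNReal.ofReal D * ENNReal.ofReal (cornerTerm a p r₁ r₂ i) := by
    intro i
    have hnn : ∀ μ ∈ blockIco i.1, ∀ ν ∈ blockIco i.2, 0 ≤ a μ ν ^ p * (μ:ℝ) ^ e₁ * (ν:ℝ) ^ e₂ := by
      intro μ hμ ν hν
      have := rpow_nonneg (ha.nonneg μ ν (one_le_of_mem_blockIco hμ) (one_le_of_mem_blockIco hν)) p
      positivity
    have e : ∑ μ ∈ blockIco i.1, ∑ ν ∈ blockIco i.2, F μ ν = ENNReal.ofReal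
        (∑ μ ∈ blockIco i.1, ∑ ν ∈ blockIco i.2, a μ ν ^ p * (μ:ℝ) ^ e₁ * (ν:ℝ) ^ e₂) := by
      rw [ENNReal.ofReal_sum_of_nonneg fun μ hμ => Finset.sum_nonneg (hnn μ hμ)]
      exact Finset.sum_congr rfl fun μ hμ => (ENNReal.ofReal_sum_of_nonneg (hnn μ hμ)).symm
    rw [e, ← ENNReal.ofReal_mul hD0]
    refine ENNReal.ofReal_le_ofReal ?_
    have hcn := rpow_nonneg (ha.corner_nonneg i) p
    have s₁ := sum_blockIco_rpow_le e₁ i.1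
    have s₂ := sum_blockIco_rpow_le e₂ i.2
    have t₁ : r₁ * p + p - 1 = e₁ + 1 := by rw [he₁]; ring
    have t₂ : r₂ * p + p - 1 = e₂ + 1 := by rw [he₂]; ring
    rw [cornerTerm, t₁, t₂]
    calc _ ≤ ∑ μ ∈ blockIco i.1, ∑ ν ∈ blockIco i.2,
            a (2 ^ i.1) (2 ^ i.2) ^ p * (μ:ℝ) ^ e₁ * (ν:ℝ) ^ e₂ := by
          gcongr with μ hμ ν hν
          · exact ha.nonneg _ _ (one_le_of_mem_blockIco hμ) (one_le_of_mem_blockIco hν)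
          · exact ha.anti Nat.one_le_two_pow Nat.one_le_two_pow
              (Finset.mem_Ico.1 hμ).1 (Finset.mem_Ico.1 hν).1
      _ = a (2 ^ i.1) (2 ^ i.2) ^ p * ((∑ ν ∈ blockIco i.1, (ν : ℝ) ^ e₁) *
          (∑ ν ∈ blockIco i.2, (ν : ℝ) ^ e₂)) := by
          simp only [← Finset.mul_sum, mul_assoc, ← Finset.sum_mul]
      _ ≤ a (2 ^ i.1) (2 ^ i.2) ^ p * ((2 ^ |e₁| * (2:ℝ) ^ (i.1 * (e₁ + 1))) *
          (2 ^ |e₂| * (2:ℝ) ^ (i.2 * (e₂ + 1)))) := by gcongr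
      _ = _ := by rw [hD]; ring
  refine (tsum_tsum_le_tsum_prod_sum_blockIco F).trans ((ENNReal.tsum_le_tsum h).trans ?_)
  rw [ENNReal.tsum_mul_left]
  rfl

/-- The exponential `exp (-i m x)`. -/
def expWave (m : ℤ) (x : ℝ) : ℂ := Complex.exp (-Complex.I * (m * x))

lemma continuous_expWave (m : ℤ) : Continuous (expWave m) := by unfold expWave; fun_prop

lemma norm_expWave (m : ℤ) (x : ℝ) : ‖expWave m x‖ = 1 := by
  rw [expWave, show -Complex.I * ((m : ℂ) * (x : ℂ)) = ((-(m * x) : ℝ) : ℂ) * Complex.I by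
    push_cast; ring, Complex.norm_exp_ofReal_mul_I]

lemma MeasureTheory.Integrable.mul_expWave {φ : ℝ → ℂ} {μ : Measure ℝ} (hφ : Integrable φ μ)
    (m : ℤ) : Integrable (fun x => φ x * expWave m x) μ :=
  hφ.mul_bdd (c := 1) (continuous_expWave m).aestronglyMeasurable
    (Filter.Eventually.of_forall fun x => (norm_expWave m x).le)

lemma MeasureTheory.Integrable.mul_expWave_mul_expWave {φ : ℝ × ℝ → ℂ} {μ : Measure (ℝ × ℝ)}
    (hφ : Integrable φ μ) (m₁ m₂ : ℤ) :
    Integrable (fun z => φ z * (expWave m₁ z.1 * expWave m₂ z.2)) μ :=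
  hφ.mul_bdd (c := 1) (((continuous_expWave m₁).comp continuous_fst).mul
    ((continuous_expWave m₂).comp continuous_snd)).aestronglyMeasurable
    (Filter.Eventually.of_forall fun x => by simp [norm_expWave])

/-- An integrable function on the period interval with vanishing Fourier coefficients vanishes
almost everywhere. -/
lemma ae_eq_zero_of_integral_mul_expWave_eq_zero {φ : ℝ → ℂ} (hφ : Integrable φ periodMeasure)
    (h : ∀ m : ℤ, ∫ x, φ x * expWave m x ∂periodMeasure = 0) :
    ∀ᵐ x ∂periodMeasure, φ x = 0 := by
  have : Fact (0 < 2 * π) := ⟨two_pi_pos⟩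
  have hi : ∀ ψ : C(AddCircle (2 * π), ℂ), Integrable (fun x : ℝ => φ x * ψ x) periodMeasure := by
    intro ψ
    refine hφ.mul_bdd (c := ‖ψ‖) ?_ (Filter.Eventually.of_forall fun x => ψ.norm_coe_le_norm _)
    exact (ψ.continuous.comp (AddCircle.continuous_mk' _)).aestronglyMeasurable
  let Λ : C(AddCircle (2 * π), ℂ) →L[ℂ] ℂ := LinearMap.mkContinuous
    { toFun := fun ψ => ∫ x, φ x * ψ x ∂periodMeasure
      map_add' := fun ψ χ => by
        simp only [ContinuousMap.add_apply, mul_add]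
        exact integral_add (hi ψ) (hi χ)
      map_smul' := fun c ψ => by
        simp only [ContinuousMap.smul_apply, smul_eq_mul, RingHom.id_apply]
        rw [← integral_const_mul]
        exact integral_congr_ae (Filter.Eventually.of_forall fun x => by ring) }
    (∫ x, ‖φ x‖ ∂periodMeasure) (fun ψ => by
      change ‖∫ x, φ x * ψ x ∂periodMeasure‖ ≤ _
      rw [← integral_mul_const]
      refine norm_integral_le_of_norm_le (hφ.norm.mul_const _)
        (Filter.Eventually.of_forall fun x => ?_)
      rw [norm_mul]
      exact mul_le_mul_of_nonneg_left (ψ.norm_coe_le_norm _) (norm_nonneg _))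
  have hΛ : Λ = 0 := by
    refine ContinuousLinearMap.ext_on (s := Set.range (@fourier (2 * π))) ?_ ?_
    · rw [Submodule.dense_iff_topologicalClosure_eq_top]
      exact span_fourier_closure_eq_top
    · rintro _ ⟨n, rfl⟩
      change ∫ x, φ x * fourier n (x : AddCircle (2 * π)) ∂periodMeasure = 0
      rw [← h (-n)]
      refine integral_congr_ae (Filter.Eventually.of_forall fun x => ?_)
      simp only [fourier_coe_apply, expWave]
      congr 2
      have : (π : ℂ) ≠ 0 := by exact_mod_cast pi_ne_zero
      push_cast
      field_simp
  have hzero : ∀ᵐ x, x ∈ Set.Ioo (0:ℝ) (2 * π) → φ x = 0 := by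
    refine isOpen_Ioo.ae_eq_zero_of_integral_contDiff_smul_eq_zero ?_ ?_
    · exact (IntegrableOn.mono_set (t := Set.Ioc 0 (2 * π)) hφ
        Set.Ioo_subset_Ioc_self).locallyIntegrableOn
    · intro g hg _ hsupp
      have hg0 : ∀ x, x ∉ Set.Ioo (0:ℝ) (2 * π) → g x = 0 := fun x hx =>
        image_eq_zero_of_notMem_tsupport fun hx' => hx (hsupp hx')
      have hcont : Continuous (AddCircle.liftIco (2 * π) 0 (fun x => (g x : ℂ))) := by
        refine AddCircle.liftIco_zero_continuous ?_ ?_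
        · rw [hg0 0 (by simp), hg0 (2 * π) (by simp)]
        · exact (Complex.continuous_ofReal.comp hg.continuous).continuousOn
      have := congrArg (fun M : C(AddCircle (2 * π), ℂ) →L[ℂ] ℂ => M ⟨_, hcont⟩) hΛ
      change ∫ x, φ x * AddCircle.liftIco (2 * π) 0 (fun x => (g x : ℂ)) x ∂periodMeasure = 0
        at this
      rw [← setIntegral_eq_integral_of_forall_compl_eq_zero (s := Set.Ioc 0 (2 * π))
        (fun x hx => by rw [hg0 x fun h => hx (Set.Ioo_subset_Ioc_self h), zero_smul])]
      rw [← this]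
      refine integral_congr_ae (ae_periodMeasure_mem_Ioo.mono fun x hx => ?_)
      simp only
      rw [AddCircle.liftIco_zero_coe_apply (Set.Ioo_subset_Ico_self hx), Complex.real_smul,
        mul_comm]
  rw [periodMeasure, Measure.restrict_congr_set Ioo_ae_eq_Ioc.symm]
  exact (ae_restrict_iff' measurableSet_Ioo).2 hzero

lemma ae_integral_mul_expWave_eq_zero {h : ℝ × ℝ → ℂ}
    (hh : Integrable h (periodMeasure.prod periodMeasure)) (m₂ : ℤ)
    (H : ∀ m₁ : ℤ, ∫ z, h z * (expWave m₁ z.1 * expWave m₂ z.2)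
      ∂(periodMeasure.prod periodMeasure) = 0) :
    ∀ᵐ x ∂periodMeasure, ∫ y, h (x, y) * expWave m₂ y ∂periodMeasure = 0 := by
  have hi := hh.mul_expWave_mul_expWave 0 m₂
  have e0 : ∀ x, expWave 0 x = 1 := fun x => by simp [expWave]
  simp only [e0, one_mul] at hi
  refine ae_eq_zero_of_integral_mul_expWave_eq_zero hi.integral_prod_left fun m₁ => ?_
  rw [← H m₁, integral_prod _ (hh.mul_expWave_mul_expWave m₁ m₂)]
  refine integral_congr_ae (Filter.Eventually.of_forall fun x => ?_)
  simp only
  rw [← integral_mul_const]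
  exact integral_congr_ae (Filter.Eventually.of_forall fun y => by ring)

lemma ae_eq_zero_of_integral_mul_expWave_mul_expWave_eq_zero {h : ℝ × ℝ → ℂ} (hm : Measurable h)
    (hh : Integrable h (periodMeasure.prod periodMeasure))
    (H : ∀ m₁ m₂ : ℤ, ∫ z, h z * (expWave m₁ z.1 * expWave m₂ z.2)
      ∂(periodMeasure.prod periodMeasure) = 0) :
    ∀ᵐ z ∂(periodMeasure.prod periodMeasure), h z = 0 := by
  have h1 : ∀ᵐ x ∂periodMeasure, ∀ m₂ : ℤ, ∫ y, h (x, y) * expWave m₂ y ∂periodMeasure = 0 :=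
    ae_all_iff.2 fun m₂ => ae_integral_mul_expWave_eq_zero hh m₂ fun m₁ => H m₁ m₂
  rw [Measure.ae_prod_iff_ae_ae (p := fun z => h z = 0) (hm (measurableSet_singleton 0))]
  filter_upwards [h1, hh.prod_right_ae] with x hx hx2
  exact ae_eq_zero_of_integral_mul_expWave_eq_zero hx2 hx

lemma ae_integral_eq_zero_of_periodic {h : ℝ → ℝ} (hper : Function.Periodic h (2 * π))
    (hz : ∀ᵐ x ∂periodMeasure, h x = 0) : ∀ᵐ x : ℝ, h x = 0 := by
  rw [periodMeasure, ae_restrict_iff' measurableSet_Ioc] at hz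
  have h1 : ∀ n : ℤ, ∀ᵐ x : ℝ, x + n • (2 * π) ∈ Set.Ioc (0:ℝ) (2 * π) → h x = 0 := by
    intro n
    have := (measurePreserving_add_right (volume : Measure ℝ)
      (n • (2 * π))).quasiMeasurePreserving.ae hz
    filter_upwards [this] with x hx hmem
    rw [← hx hmem, hper.zsmul n x]
  filter_upwards [ae_all_iff.2 h1] with x hx
  obtain ⟨n, hn, _⟩ := existsUnique_add_zsmul_mem_Ioc two_pi_pos x 0
  exact hx n (by simpa using hn)

lemma ofReal_abs_le_one_add_rpow {p : ℝ} (hp : 1 ≤ p) (t : ℝ) :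
    ENNReal.ofReal |t| ≤ 1 + ENNReal.ofReal (|t| ^ p) := by
  rw [← ENNReal.ofReal_one, ← ENNReal.ofReal_add zero_le_one (by positivity)]
  refine ENNReal.ofReal_le_ofReal ?_
  rcases le_total |t| 1 with h | h
  · have : 0 ≤ |t| ^ p := by positivity
    linarith
  · have : |t| ≤ |t| ^ p := by simpa using rpow_le_rpow_of_exponent_le h hp
    linarith

lemma Lp2Norm_eq {f : ℝ → ℝ → ℝ} (hf : Measurable (Function.uncurry f)) (p : ℝ) :
    Lp2Norm p f = (∫⁻ z : ℝ × ℝ, ENNReal.ofReal (|f z.1 z.2| ^ p)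
      ∂(periodMeasure.prod periodMeasure)) ^ (1 / p) := by
  have hm : Measurable fun z : ℝ × ℝ => ENNReal.ofReal (|f z.1 z.2| ^ p) :=
    ((measurable_norm.comp hf).pow_const p).ennreal_ofReal
  rw [lintegral_prod _ hm.aemeasurable]
  rfl

lemma integrable_of_lintegral_rpow_ne_top {f : ℝ → ℝ → ℝ} (hf : Measurable (Function.uncurry f))
    {p : ℝ} (hp : 1 ≤ p) (h : ∫⁻ z : ℝ × ℝ, ENNReal.ofReal (|f z.1 z.2| ^ p)
      ∂(periodMeasure.prod periodMeasure) ≠ ⊤) :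
    Integrable (fun z : ℝ × ℝ => f z.1 z.2) (periodMeasure.prod periodMeasure) := by
  refine ⟨hf.aestronglyMeasurable, ?_⟩
  rw [hasFiniteIntegral_iff_norm]
  calc _ ≤ ∫⁻ z : ℝ × ℝ, (1 + ENNReal.ofReal (|f z.1 z.2| ^ p))
        ∂(periodMeasure.prod periodMeasure) :=
        lintegral_mono fun z => ofReal_abs_le_one_add_rpow hp _
    _ < ⊤ := by
        rw [lintegral_add_left measurable_const]
        exact ENNReal.add_lt_top.2 ⟨by simp, h.lt_top⟩

lemma MemLp0.integrable {p : ℝ} (hp : 1 ≤ p) {f : ℝ → ℝ → ℝ} (hf : MemLp0 p f) :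
    Integrable (fun z : ℝ × ℝ => f z.1 z.2) (periodMeasure.prod periodMeasure) := by
  refine integrable_of_lintegral_rpow_ne_top hf.meas hp fun h => hf.norm_ne_top ?_
  rw [Lp2Norm_eq hf.meas, h, ENNReal.top_rpow_of_pos (by positivity)]

lemma intervalIntegral_intervalIntegral_eq {E : Type*} [NormedAddCommGroup E] [NormedSpace ℝ E]
    {h : ℝ → ℝ → E}
    (hh : Integrable (fun z : ℝ × ℝ => h z.1 z.2) (periodMeasure.prod periodMeasure)) :
    ∫ x in (0:ℝ)..(2 * π), ∫ y in (0:ℝ)..(2 * π), h x y =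
      ∫ z : ℝ × ℝ, h z.1 z.2 ∂(periodMeasure.prod periodMeasure) := by
  rw [integral_prod _ hh]
  simp only [intervalIntegral.integral_of_le two_pi_pos.le]
  rfl

lemma fourierCoefZ_eq {f : ℝ → ℝ → ℝ}
    (hf : Integrable (fun z : ℝ × ℝ => f z.1 z.2) (periodMeasure.prod periodMeasure))
    (m₁ m₂ : ℤ) : fourierCoefZ f m₁ m₂ = (((2 * π) ^ 2)⁻¹ : ℝ) *
      ∫ z : ℝ × ℝ, (f z.1 z.2 : ℂ) * (expWave m₁ z.1 * expWave m₂ z.2)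
        ∂(periodMeasure.prod periodMeasure) := by
  rw [fourierCoefZ, ← intervalIntegral_intervalIntegral_eq
    (h := fun x y => (f x y : ℂ) * (expWave m₁ x * expWave m₂ y))
    (hf.ofReal.mul_expWave_mul_expWave m₁ m₂)]
  congr! 6
  rw [expWave, expWave, ← Complex.exp_add]
  ring_nf

lemma ae_eq_of_fourierCoefZ_eq {f g : ℝ → ℝ → ℝ} (hfm : Measurable (Function.uncurry f))
    (hgm : Measurable (Function.uncurry g))
    (hf : Integrable (fun z : ℝ × ℝ => f z.1 z.2) (periodMeasure.prod periodMeasure))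
    (hg : Integrable (fun z : ℝ × ℝ => g z.1 z.2) (periodMeasure.prod periodMeasure))
    (h : ∀ m₁ m₂, fourierCoefZ f m₁ m₂ = fourierCoefZ g m₁ m₂) :
    ∀ᵐ z ∂(periodMeasure.prod periodMeasure), f z.1 z.2 = g z.1 z.2 := by
  have hm : Measurable fun z : ℝ × ℝ => (f z.1 z.2 : ℂ) - (g z.1 z.2 : ℂ) :=
    (Complex.measurable_ofReal.comp hfm).sub (Complex.measurable_ofReal.comp hgm)
  have hfc : Integrable (fun z : ℝ × ℝ => (f z.1 z.2 : ℂ)) (periodMeasure.prod periodMeasure) :=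
    hf.ofReal
  have hgc : Integrable (fun z : ℝ × ℝ => (g z.1 z.2 : ℂ)) (periodMeasure.prod periodMeasure) :=
    hg.ofReal
  refine (ae_eq_zero_of_integral_mul_expWave_mul_expWave_eq_zero hm
    (hfc.sub hgc) fun m₁ m₂ => ?_).mono fun z hz => ?_
  · have e := h m₁ m₂
    rw [fourierCoefZ_eq hf, fourierCoefZ_eq hg] at e
    have hc : ((((2 * π) ^ 2)⁻¹ : ℝ) : ℂ) ≠ 0 := by
      exact_mod_cast (by positivity : ((2 * π) ^ 2)⁻¹ ≠ 0)
    have e2 := mul_left_cancel₀ hc e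
    simp only [sub_mul]
    rw [integral_sub (hfc.mul_expWave_mul_expWave m₁ m₂)
      (hgc.mul_expWave_mul_expWave m₁ m₂)]
    exact sub_eq_zero.2 e2
  · exact_mod_cast sub_eq_zero.1 hz

lemma tendsto_integral_mul_expWave (φ : ℝ → ℂ) :
    Filter.Tendsto (fun n : ℕ => ∫ x, φ x * expWave n x ∂periodMeasure) Filter.atTop (nhds 0) := by
  have h := Real.tendsto_integral_exp_smul_cocompact ((Set.Ioc (0:ℝ) (2 * π)).indicator φ)
  have hn : Filter.Tendsto (fun n : ℕ => (n : ℝ) / (2 * π)) Filter.atTop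
      (Filter.cocompact ℝ) :=
    (tendsto_natCast_atTop_atTop.atTop_div_const two_pi_pos).mono_right atTop_le_cocompact
  refine (h.comp hn).congr fun n => ?_
  rw [periodMeasure, ← integral_indicator measurableSet_Ioc]
  refine integral_congr_ae (Filter.Eventually.of_forall fun x => ?_)
  simp only [Set.indicator_apply]
  split_ifs with hx
  · rw [Circle.smul_def, Real.fourierChar_apply, smul_eq_mul, mul_comm, expWave]
    congr 2
    have : (π : ℂ) ≠ 0 := by exact_mod_cast pi_ne_zero
    push_cast
    field_simp
  · simp

lemma expWave_eq (m : ℤ) (x : ℝ) : expWave m x =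
    (cos (m * x) : ℝ) - (sin (m * x) : ℝ) * Complex.I := by
  rw [expWave, show -Complex.I * ((m : ℂ) * (x : ℂ)) = ((-(m * x) : ℝ) : ℂ) * Complex.I by
    push_cast; ring, Complex.exp_mul_I, ← Complex.ofReal_cos, ← Complex.ofReal_sin,
    cos_neg, sin_neg]
  push_cast
  ring

lemma tendsto_integral_mul_cos {φ : ℝ → ℝ} (hφ : Integrable φ periodMeasure) :
    Filter.Tendsto (fun n : ℕ => ∫ x, φ x * cos (n * x) ∂periodMeasure) Filter.atTop (nhds 0) := by
  have h := (Complex.continuous_re.tendsto 0).comp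
    (tendsto_integral_mul_expWave (fun x => (φ x : ℂ)))
  simp only [Complex.zero_re] at h
  have hφc : Integrable (fun x => (φ x : ℂ)) periodMeasure := hφ.ofReal
  refine h.congr fun n => ?_
  change (∫ x, (φ x : ℂ) * expWave n x ∂periodMeasure).re = _
  rw [← RCLike.re_eq_complex_re, ← integral_re (hφc.mul_expWave n)]
  refine integral_congr_ae (Filter.Eventually.of_forall fun x => ?_)
  simp only [expWave_eq, Int.cast_natCast, RCLike.re_eq_complex_re, Complex.re_ofReal_mul,
    Complex.sub_re, Complex.ofReal_re,
    Complex.I_re, mul_zero, sub_zero]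

/-- A function of two variables integrates against products of bounded continuous functions. -/
lemma MeasureTheory.Integrable.mul_continuous_mul {f : ℝ × ℝ → ℝ} {μ : Measure (ℝ × ℝ)}
    (hf : Integrable f μ) {u v : ℝ → ℝ} (hu : Continuous u) (hv : Continuous v)
    (hu1 : ∀ x, |u x| ≤ 1) (hv1 : ∀ x, |v x| ≤ 1) :
    Integrable (fun z => f z * u z.1 * v z.2) μ := by
  simp only [mul_assoc]
  refine hf.mul_bdd (c := 1) ((hu.comp continuous_fst).mul
    (hv.comp continuous_snd)).aestronglyMeasurable (Filter.Eventually.of_forall fun z => ?_)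
  rw [norm_mul]
  exact mul_le_one₀ (hu1 _) (norm_nonneg _) (hv1 _)

lemma tendsto_fourierCC_left {f : ℝ → ℝ → ℝ}
    (hf : Integrable (fun z : ℝ × ℝ => f z.1 z.2) (periodMeasure.prod periodMeasure)) (n : ℕ) :
    Filter.Tendsto (fun m => fourierCC f m n) Filter.atTop (nhds 0) := by
  have hi := hf.mul_continuous_mul (u := fun _ => 1) (v := fun y => cos (n * y)) continuous_const
    (by fun_prop) (by simp) (fun _ => abs_cos_le_one _)
  rw [← mul_zero (1 / π ^ 2)]
  refine ((tendsto_integral_mul_cos hi.integral_prod_left).congr fun m => ?_).const_mul _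
  rw [intervalIntegral.integral_of_le two_pi_pos.le]
  refine integral_congr_ae (Filter.Eventually.of_forall fun x => ?_)
  simp only
  rw [intervalIntegral.integral_of_le two_pi_pos.le, ← integral_mul_const]
  exact integral_congr_ae (Filter.Eventually.of_forall fun y => by simp only; ring)

lemma fourierCC_eq {f : ℝ → ℝ → ℝ}
    (hf : Integrable (fun z : ℝ × ℝ => f z.1 z.2) (periodMeasure.prod periodMeasure)) (m n : ℕ) :
    fourierCC f m n = (1 / π ^ 2) * ∫ z : ℝ × ℝ, f z.1 z.2 * cos (m * z.1) * cos (n * z.2)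
      ∂(periodMeasure.prod periodMeasure) := by
  rw [fourierCC, intervalIntegral_intervalIntegral_eq
    (h := fun x y => f x y * cos (m * x) * cos (n * y))]
  exact hf.mul_continuous_mul (u := fun x => cos (m * x)) (v := fun y => cos (n * y)) (by fun_prop)
    (by fun_prop) (fun _ => abs_cos_le_one _) (fun _ => abs_cos_le_one _)

lemma fourierCC_swap {f : ℝ → ℝ → ℝ}
    (hf : Integrable (fun z : ℝ × ℝ => f z.1 z.2) (periodMeasure.prod periodMeasure)) (m n : ℕ) :
    fourierCC (fun x y => f y x) m n = fourierCC f n m := by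
  rw [fourierCC_eq hf, fourierCC_eq (f := fun x y => f y x) hf.swap, ← integral_prod_swap]
  congr 1
  refine integral_congr_ae (Filter.Eventually.of_forall fun z => ?_)
  simp only [Prod.fst_swap, Prod.snd_swap]
  ring

lemma tendsto_fourierCC_right {f : ℝ → ℝ → ℝ}
    (hf : Integrable (fun z : ℝ × ℝ => f z.1 z.2) (periodMeasure.prod periodMeasure)) (m : ℕ) :
    Filter.Tendsto (fun n => fourierCC f m n) Filter.atTop (nhds 0) :=
  (tendsto_fourierCC_left (f := fun x y => f y x) hf.swap m).congr fun n => fourierCC_swap hf n m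

/-- A double sequence with nonnegative mixed differences which tends to zero along rows and
columns is doubly monotone. -/
lemma DoublyMonotone.of_tendsto {a : ℕ → ℕ → ℝ}
    (h : ∀ i j, 1 ≤ i → 1 ≤ j → 0 ≤ a i j - a (i + 1) j - a i (j + 1) + a (i + 1) (j + 1))
    (hl : ∀ j, 1 ≤ j → Filter.Tendsto (fun i => a i j) Filter.atTop (nhds 0))
    (hr : ∀ i, 1 ≤ i → Filter.Tendsto (fun j => a i j) Filter.atTop (nhds 0)) :
    DoublyMonotone a := by
  have key : ∀ b : ℕ → ℝ, (∀ i, 1 ≤ i → b (i + 1) ≤ b i) →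
      Filter.Tendsto b Filter.atTop (nhds 0) → ∀ i, 1 ≤ i → 0 ≤ b i := by
    intro b hb ht i hi
    refine le_of_tendsto' ((Filter.tendsto_add_atTop_iff_nat i).2 ht) fun n => ?_
    induction n with
    | zero => simp
    | succ n ih =>
      have := hb (n + i) (by omega)
      rw [add_right_comm] at this
      exact this.trans ih
  have hL : ∀ i j, 1 ≤ i → 1 ≤ j → a (i + 1) j ≤ a i j := by
    intro i j hi hj
    refine sub_nonneg.1 (key (fun j => a i j - a (i + 1) j) (fun j hj => ?_) ?_ j hj)
    · linarith [h i j hi hj]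
    · simpa using (hr i hi).sub (hr (i + 1) (by omega))
  have hR : ∀ i j, 1 ≤ i → 1 ≤ j → a i (j + 1) ≤ a i j := by
    intro i j hi hj
    refine sub_nonneg.1 (key (fun i => a i j - a i (j + 1)) (fun i hi => ?_) ?_ i hi)
    · linarith [h i j hi hj]
    · simpa using (hl j hj).sub (hl (j + 1) (by omega))
  exact ⟨fun i j hi hj => key (fun i => a i j) (fun i hi => hL i j hi hj) (hl j hj) i hi, hL, hR, h⟩

lemma InMclass.doublyMonotone {p : ℝ} (hp : 1 ≤ p) {f : ℝ → ℝ → ℝ} {a : ℕ → ℕ → ℝ}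
    (h : InMclass p f a) : DoublyMonotone a := by
  have hf := h.1.integrable hp
  refine .of_tendsto h.2.2.2 (fun j hj => ?_) fun i hi => ?_
  · refine (tendsto_fourierCC_left hf j).congr' ?_
    filter_upwards [Filter.eventually_ge_atTop 1] with i hi using h.2.1 i j hi hj
  · refine (tendsto_fourierCC_right hf i).congr' ?_
    filter_upwards [Filter.eventually_ge_atTop 1] with j hj using h.2.1 i j hi hj

lemma cos_intCast_mul (m : ℤ) (x : ℝ) : cos (m * x) = cos (m.natAbs * x) := by
  obtain h | h := Int.natAbs_eq m
  · rw [h]; simp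
  · rw [h]; simp

lemma sin_intCast_mul (m : ℤ) (x : ℝ) : sin (m * x) = (m.sign : ℝ) * sin (m.natAbs * x) := by
  rcases lt_trichotomy m 0 with h | rfl | h
  · rw [Int.sign_eq_neg_one_of_neg h]
    have : (m : ℝ) = -(m.natAbs : ℝ) := by
      rw [← Int.cast_natCast, ← Int.cast_neg]
      exact congrArg _ (by omega)
    rw [this]; simp
  · simp
  · rw [Int.sign_eq_one_of_pos h]
    have : (m : ℝ) = (m.natAbs : ℝ) := by
      rw [← Int.cast_natCast]
      exact congrArg _ (by omega)
    rw [this]; simp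

lemma fourierCC_zero_left {p : ℝ} (hp : 1 ≤ p) {f : ℝ → ℝ → ℝ} (hf : MemLp0 p f) (n : ℕ) :
    fourierCC f 0 n = 0 := by
  have hi := hf.integrable hp
  rw [fourierCC_eq hi, integral_prod_symm _ (hi.mul_continuous_mul (u := fun x => cos ((0 : ℕ) * x))
    (v := fun y => cos (n * y)) (by fun_prop) (by fun_prop) (fun _ => abs_cos_le_one _)
    (fun _ => abs_cos_le_one _)), integral_eq_zero_of_ae, mul_zero]
  filter_upwards [ae_restrict_of_ae hf.mean_x] with y hy
  rw [intervalIntegral.integral_of_le two_pi_pos.le] at hy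
  simp only [Nat.cast_zero, zero_mul, cos_zero, mul_one, Pi.zero_apply]
  rw [integral_mul_const]
  exact mul_eq_zero_of_left hy _

lemma fourierCC_zero_right {p : ℝ} (hp : 1 ≤ p) {f : ℝ → ℝ → ℝ} (hf : MemLp0 p f) (n : ℕ) :
    fourierCC f n 0 = 0 := by
  have hi := hf.integrable hp
  rw [fourierCC_eq hi, integral_prod _ (hi.mul_continuous_mul (u := fun x => cos (n * x))
    (v := fun y => cos ((0 : ℕ) * y)) (by fun_prop) (by fun_prop) (fun _ => abs_cos_le_one _)
    (fun _ => abs_cos_le_one _)), integral_eq_zero_of_ae, mul_zero]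
  filter_upwards [ae_restrict_of_ae hf.mean_y] with x hx
  rw [intervalIntegral.integral_of_le two_pi_pos.le] at hx
  simp only [Nat.cast_zero, zero_mul, cos_zero, mul_one, Pi.zero_apply]
  rw [integral_mul_const]
  exact mul_eq_zero_of_left hx _

lemma integral_ofReal_add_ofReal_mul_I {α : Type*} [MeasurableSpace α] {μ : Measure α}
    {u v : α → ℝ} (hu : Integrable u μ) (hv : Integrable v μ) :
    ∫ z, ((u z : ℂ) + (v z : ℂ) * Complex.I) ∂μ = (∫ z, u z ∂μ : ℝ) +
      (∫ z, v z ∂μ : ℝ) * Complex.I := by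
  have huc : Integrable (fun z => (u z : ℂ)) μ := hu.ofReal
  have hvc : Integrable (fun z => (v z : ℂ)) μ := hv.ofReal
  rw [integral_add huc (hvc.mul_const _), integral_mul_const, integral_complex_ofReal,
    integral_complex_ofReal]

lemma fourierCoefZ_eq_fourierCC {f : ℝ → ℝ → ℝ}
    (hf : Integrable (fun z : ℝ × ℝ => f z.1 z.2) (periodMeasure.prod periodMeasure))
    (h : ∀ n₁ n₂ : ℕ, fourierSC f n₁ n₂ = 0 ∧ fourierCS f n₁ n₂ = 0 ∧ fourierSS f n₁ n₂ = 0)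
    (m₁ m₂ : ℤ) : fourierCoefZ f m₁ m₂ = (fourierCC f m₁.natAbs m₂.natAbs / 4 : ℝ) := by
  set k := m₁.natAbs
  set l := m₂.natAbs
  have hpi : (1 / π ^ 2) ≠ 0 := by positivity
  have iCC := hf.mul_continuous_mul (u := fun x => cos (k * x)) (v := fun y => cos (l * y))
    (by fun_prop) (by fun_prop) (fun _ => abs_cos_le_one _) (fun _ => abs_cos_le_one _)
  have iSC := hf.mul_continuous_mul (u := fun x => sin (k * x)) (v := fun y => cos (l * y))
    (by fun_prop) (by fun_prop) (fun _ => abs_sin_le_one _) (fun _ => abs_cos_le_one _)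
  have iCS := hf.mul_continuous_mul (u := fun x => cos (k * x)) (v := fun y => sin (l * y))
    (by fun_prop) (by fun_prop) (fun _ => abs_cos_le_one _) (fun _ => abs_sin_le_one _)
  have iSS := hf.mul_continuous_mul (u := fun x => sin (k * x)) (v := fun y => sin (l * y))
    (by fun_prop) (by fun_prop) (fun _ => abs_sin_le_one _) (fun _ => abs_sin_le_one _)
  obtain ⟨hSC, hCS, hSS⟩ := h k l
  rw [fourierSC, intervalIntegral_intervalIntegral_eq
    (h := fun x y => f x y * sin (k * x) * cos (l * y)) iSC] at hSC
  rw [fourierCS, intervalIntegral_intervalIntegral_eq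
    (h := fun x y => f x y * cos (k * x) * sin (l * y)) iCS] at hCS
  rw [fourierSS, intervalIntegral_intervalIntegral_eq
    (h := fun x y => f x y * sin (k * x) * sin (l * y)) iSS] at hSS
  replace hSC := (mul_eq_zero.1 hSC).resolve_left hpi
  replace hCS := (mul_eq_zero.1 hCS).resolve_left hpi
  replace hSS := (mul_eq_zero.1 hSS).resolve_left hpi
  have e : ∀ z : ℝ × ℝ, (f z.1 z.2 : ℂ) * (expWave m₁ z.1 * expWave m₂ z.2) =
      ((f z.1 z.2 * cos (k * z.1) * cos (l * z.2) -
        m₁.sign * m₂.sign * (f z.1 z.2 * sin (k * z.1) * sin (l * z.2)) : ℝ) : ℂ) +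
      ((-m₁.sign * (f z.1 z.2 * sin (k * z.1) * cos (l * z.2)) -
        m₂.sign * (f z.1 z.2 * cos (k * z.1) * sin (l * z.2)) : ℝ) : ℂ) * Complex.I := by
    intro z
    rw [expWave_eq, expWave_eq, cos_intCast_mul, cos_intCast_mul, sin_intCast_mul, sin_intCast_mul]
    push_cast
    linear_combination ((f z.1 z.2 : ℂ) * (m₁.sign * Complex.sin (k * z.1) *
      (m₂.sign * Complex.sin (l * z.2)))) * Complex.I_sq
  have h1 := iCC.sub (iSS.const_mul ((m₁.sign : ℝ) * m₂.sign))
  have h2 := (iSC.const_mul (-(m₁.sign : ℝ))).sub (iCS.const_mul (m₂.sign : ℝ))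
  rw [fourierCoefZ_eq hf, fourierCC_eq hf, integral_congr_ae (Filter.Eventually.of_forall e)]
  have e1 : ∫ z : ℝ × ℝ, (f z.1 z.2 * cos (k * z.1) * cos (l * z.2) -
        m₁.sign * m₂.sign * (f z.1 z.2 * sin (k * z.1) * sin (l * z.2)))
        ∂(periodMeasure.prod periodMeasure) = ∫ z : ℝ × ℝ, f z.1 z.2 * cos (k * z.1) * cos (l * z.2)
        ∂(periodMeasure.prod periodMeasure) := by
    rw [integral_sub iCC (iSS.const_mul _), integral_const_mul, hSS, mul_zero, sub_zero]
  have e2 : ∫ z : ℝ × ℝ, (-m₁.sign * (f z.1 z.2 * sin (k * z.1) * cos (l * z.2)) -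
        m₂.sign * (f z.1 z.2 * cos (k * z.1) * sin (l * z.2)))
        ∂(periodMeasure.prod periodMeasure) = 0 := by
    rw [integral_sub (iSC.const_mul _) (iCS.const_mul _), integral_const_mul, integral_const_mul,
      hSC, hCS, mul_zero, mul_zero, sub_zero]
  refine (congrArg _ (integral_ofReal_add_ofReal_mul_I h1 h2)).trans ?_
  simp only [Pi.sub_apply, e1, e2]
  push_cast
  have : (π : ℂ) ≠ 0 := by exact_mod_cast pi_ne_zero
  field_simp
  ring

lemma expWave_add (m n : ℤ) (x : ℝ) : expWave (m + n) x = expWave m x * expWave n x := by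
  rw [expWave, expWave, expWave, ← Complex.exp_add]
  push_cast
  ring_nf

lemma integral_expWave (m : ℤ) :
    ∫ x, expWave m x ∂periodMeasure = if m = 0 then 2 * (π : ℂ) else 0 := by
  rw [periodMeasure, ← intervalIntegral.integral_of_le two_pi_pos.le]
  split_ifs with h
  · simp [h, expWave]
  · have hc : -Complex.I * (m : ℂ) ≠ 0 := by simp [h]
    have e : ∀ x : ℝ, expWave m x = Complex.exp (-Complex.I * m * x) := fun x => by
      rw [expWave, mul_assoc]
    simp only [e]
    rw [integral_exp_mul_complex hc]
    have : Complex.exp (-Complex.I * m * ((2 * π : ℝ) : ℂ)) = 1 := by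
      rw [← Complex.exp_int_mul_two_pi_mul_I (-m)]
      push_cast
      ring_nf
    rw [this]
    simp

/-- The Weyl derivative of order `r` of `x ↦ cos (n x)`. -/
def weylCos (r : ℝ) (n : ℕ) (x : ℝ) : ℝ := (n : ℝ) ^ r * cos (n * x + π * r / 2)

lemma continuous_weylCos (r : ℝ) (n : ℕ) : Continuous (weylCos r n) := by
  unfold weylCos
  fun_prop

lemma periodic_weylCos (r : ℝ) (n : ℕ) : Function.Periodic (weylCos r n) (2 * π) := by
  intro x
  rw [weylCos, weylCos, show n * (x + 2 * π) + π * r / 2 = n * x + π * r / 2 + n * (2 * π) by ring,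
    cos_add_nat_mul_two_pi]

lemma ofReal_mul_cpow {n : ℝ} (hn : 0 < n) {w : ℂ} (hw : w ≠ 0) (r : ℂ) :
    (n * w) ^ r = (n : ℂ) ^ r * w ^ r := by
  have hn' : (n : ℂ) ≠ 0 := by exact_mod_cast hn.ne'
  rw [Complex.cpow_def_of_ne_zero (mul_ne_zero hn' hw), Complex.cpow_def_of_ne_zero hn',
    Complex.cpow_def_of_ne_zero hw, Complex.log_ofReal_mul hn hw, ← Complex.exp_add,
    Complex.ofReal_log hn.le]
  ring_nf

lemma I_mul_natCast_cpow {n : ℕ} (hn : 1 ≤ n) (r : ℝ) : (Complex.I * (n : ℤ)) ^ (r : ℂ) =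
    ((n : ℝ) ^ r : ℝ) * Complex.exp ((π * r / 2 : ℝ) * Complex.I) := by
  have hn' : (0:ℝ) < n := by exact_mod_cast hn
  rw [show Complex.I * (n : ℤ) = ((n : ℝ) : ℂ) * Complex.I by push_cast; ring,
    ofReal_mul_cpow hn' Complex.I_ne_zero, Complex.ofReal_cpow hn'.le,
    Complex.cpow_def_of_ne_zero Complex.I_ne_zero, Complex.log_I]
  push_cast
  ring_nf

lemma I_mul_neg_natCast_cpow {n : ℕ} (hn : 1 ≤ n) (r : ℝ) : (Complex.I * (-n : ℤ)) ^ (r : ℂ) =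
    ((n : ℝ) ^ r : ℝ) * Complex.exp (-(π * r / 2 : ℝ) * Complex.I) := by
  have hn' : (0:ℝ) < n := by exact_mod_cast hn
  rw [show Complex.I * (-n : ℤ) = ((n : ℝ) : ℂ) * -Complex.I by push_cast; ring,
    ofReal_mul_cpow hn' (neg_ne_zero.2 Complex.I_ne_zero), Complex.ofReal_cpow hn'.le,
    Complex.cpow_def_of_ne_zero (neg_ne_zero.2 Complex.I_ne_zero), Complex.log_neg_I]
  push_cast
  ring_nf

lemma I_mul_natCast_cpow_mul_neg {n : ℕ} (hn : 1 ≤ n) (r : ℝ) :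
    (Complex.I * (n : ℤ)) ^ (r : ℂ) * (Complex.I * (-n : ℤ)) ^ (r : ℂ) =
      ((n : ℝ) ^ (2 * r) : ℝ) := by
  have hn' : (0:ℝ) < n := by exact_mod_cast hn
  rw [I_mul_natCast_cpow hn, I_mul_neg_natCast_cpow hn, mul_mul_mul_comm, ← Complex.exp_add,
    neg_mul, add_neg_cancel, Complex.exp_zero, mul_one, ← Complex.ofReal_mul, ← rpow_add hn',
    two_mul]

lemma ofReal_weylCos {n : ℕ} (hn : 1 ≤ n) (r x : ℝ) : (weylCos r n x : ℂ) =
    ((Complex.I * (n : ℤ)) ^ (r : ℂ) * expWave (-n) x +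
      (Complex.I * (-n : ℤ)) ^ (r : ℂ) * expWave n x) / 2 := by
  rw [I_mul_natCast_cpow hn, I_mul_neg_natCast_cpow hn, weylCos, expWave, expWave, mul_assoc,
    mul_assoc, ← Complex.exp_add, ← Complex.exp_add,
    Complex.ofReal_mul, Complex.ofReal_cos, Complex.cos]
  push_cast
  ring_nf

lemma integral_weylCos_mul_expWave {n : ℕ} (hn : 1 ≤ n) (r : ℝ) (m : ℤ) :
    ∫ x, (weylCos r n x : ℂ) * expWave m x ∂periodMeasure =
      if m.natAbs = n then π * (Complex.I * m) ^ (r : ℂ) else 0 := by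
  have hi : ∀ k, Integrable (expWave k) periodMeasure := fun k =>
    .of_bound (C := 1) (continuous_expWave k).aestronglyMeasurable
      (Filter.Eventually.of_forall fun x => (norm_expWave k x).le)
  have e : ∀ x, (weylCos r n x : ℂ) * expWave m x =
      (Complex.I * (n : ℤ)) ^ (r : ℂ) / 2 * expWave (-n + m) x +
        (Complex.I * (-n : ℤ)) ^ (r : ℂ) / 2 * expWave (n + m) x := fun x => by
    rw [ofReal_weylCos hn, expWave_add, expWave_add]
    ring
  rw [integral_congr_ae (Filter.Eventually.of_forall e), integral_add ((hi _).const_mul _)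
    ((hi _).const_mul _), integral_const_mul, integral_const_mul, integral_expWave,
    integral_expWave]
  rcases Int.natAbs_eq m with h | h
  · split_ifs with h1 h2 h3 h4 h5 <;> try omega
    · rw [show m = n by omega]; ring
    · simp
  · split_ifs with h1 h2 h3 h4 h5 <;> try omega
    · rw [show m = -n by omega]; push_cast; ring
    · simp

/-- The integral of a function with Fourier coefficients given by Weyl multipliers against
Weyl derivatives of cosines. -/
lemma integral_mul_weylCos_mul_weylCos {f g : ℝ → ℝ → ℝ} {r₁ r₂ : ℝ}
    (hg : Integrable (fun z : ℝ × ℝ => g z.1 z.2) (periodMeasure.prod periodMeasure))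
    (h : ∀ m₁ m₂ : ℤ, fourierCoefZ g m₁ m₂ =
      (Complex.I * (m₁ : ℂ)) ^ (r₁ : ℂ) * (Complex.I * (m₂ : ℂ)) ^ (r₂ : ℂ) * fourierCoefZ f m₁ m₂)
    {n₁ n₂ : ℕ} {a : ℝ} (ha : ∀ m₁ m₂ : ℤ, m₁.natAbs = n₁ → m₂.natAbs = n₂ →
      fourierCoefZ f m₁ m₂ = (a / 4 : ℝ)) (hn₁ : 1 ≤ n₁) (hn₂ : 1 ≤ n₂) :
    ∫ z : ℝ × ℝ, g z.1 z.2 * (weylCos r₁ n₁ z.1 * weylCos r₂ n₂ z.2)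
      ∂(periodMeasure.prod periodMeasure) =
    π ^ 2 * (a * ((n₁ : ℝ) ^ (2 * r₁) * (n₂ : ℝ) ^ (2 * r₂))) := by
  have hgc : Integrable (fun z : ℝ × ℝ => (g z.1 z.2 : ℂ)) (periodMeasure.prod periodMeasure) :=
    hg.ofReal
  have hpi : (π : ℂ) ≠ 0 := by exact_mod_cast pi_ne_zero
  have hc : ∀ m₁ m₂ : ℤ, m₁.natAbs = n₁ → m₂.natAbs = n₂ →
      ∫ z : ℝ × ℝ, (g z.1 z.2 : ℂ) * (expWave m₁ z.1 * expWave m₂ z.2)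
        ∂(periodMeasure.prod periodMeasure) =
      π ^ 2 * a * (Complex.I * (m₁ : ℂ)) ^ (r₁ : ℂ) * (Complex.I * (m₂ : ℂ)) ^ (r₂ : ℂ) := by
    intro m₁ m₂ h₁ h₂
    have := h m₁ m₂
    rw [fourierCoefZ_eq hg, ha m₁ m₂ h₁ h₂] at this
    generalize ∫ z : ℝ × ℝ, (g z.1 z.2 : ℂ) * (expWave m₁ z.1 * expWave m₂ z.2)
      ∂(periodMeasure.prod periodMeasure) = J at this ⊢
    push_cast at this
    field_simp at this
    linear_combination this / 4
  have hi := fun m₁ m₂ : ℤ => hgc.mul_expWave_mul_expWave m₁ m₂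
  have e : ∀ z : ℝ × ℝ, ((g z.1 z.2 * (weylCos r₁ n₁ z.1 * weylCos r₂ n₂ z.2) : ℝ) : ℂ) =
      ∑ s : Bool × Bool, 4⁻¹ * (Complex.I * ((bif s.1 then n₁ else -n₁ : ℤ) : ℂ)) ^ (r₁ : ℂ) *
        (Complex.I * ((bif s.2 then n₂ else -n₂ : ℤ) : ℂ)) ^ (r₂ : ℂ) *
        ((g z.1 z.2 : ℂ) * (expWave (bif s.1 then -n₁ else n₁) z.1 *
          expWave (bif s.2 then -n₂ else n₂) z.2)) := by
    intro z
    rw [Complex.ofReal_mul, Complex.ofReal_mul, ofReal_weylCos hn₁, ofReal_weylCos hn₂,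
      Fintype.sum_prod_type]
    simp only [Fintype.sum_bool, cond_true, cond_false]
    ring
  rw [← Complex.ofReal_inj, ← integral_complex_ofReal,
    integral_congr_ae (Filter.Eventually.of_forall e),
    integral_finsetSum _ fun s _ => (hi _ _).const_mul _, Fintype.sum_prod_type]
  simp only [integral_const_mul, Fintype.sum_bool, cond_true, cond_false]
  rw [hc (-n₁) (-n₂) (by simp) (by simp), hc (-n₁) n₂ (by simp) (by simp),
    hc n₁ (-n₂) (by simp) (by simp), hc n₁ n₂ (by simp) (by simp)]
  push_cast [← I_mul_natCast_cpow_mul_neg hn₁ r₁, ← I_mul_natCast_cpow_mul_neg hn₂ r₂]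
  ring

lemma ofReal_abs_rpow_eq {p : ℝ} (hp : 0 ≤ p) (t : ℝ) : ENNReal.ofReal (|t| ^ p) = ‖t‖ₑ ^ p := by
  rw [Real.enorm_eq_ofReal_abs, ENNReal.ofReal_rpow_of_nonneg (abs_nonneg t) hp]

/-- The bound for partial sums of `weylCos r` over the `k`-th dyadic block. -/
def weylBound (r : ℝ) (k : ℕ) : ℝ := 2 * 2 ^ r * (2:ℝ) ^ (k * r)

lemma weylBound_pos (r : ℝ) (k : ℕ) : 0 < weylBound r k := by unfold weylBound; positivity

lemma abs_sum_weylCos_le {r : ℝ} (hr : 0 ≤ r) {x : ℝ} (hx : x ∈ Set.Ioo 0 (2 * π)) (k m n : ℕ)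
    (hn : n ≤ 2 ^ (k + 1)) : |∑ ν ∈ Finset.Ico m n, weylCos r ν x| ≤
      weylBound r k * min (2 ^ k) (1 / edgeDist x) :=
  abs_sum_rpow_mul_cos_le hr _ hx k m n hn

/-- The dyadic block of the formal Weyl derivative of `∑ a μ ν cos (μ x) cos (ν y)`. -/
def weylBlock (a : ℕ → ℕ → ℝ) (r₁ r₂ : ℝ) (i : ℕ × ℕ) (z : ℝ × ℝ) : ℝ :=
  ∑ μ ∈ blockIco i.1, ∑ ν ∈ blockIco i.2, a μ ν * (weylCos r₁ μ z.1 * weylCos r₂ ν z.2)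

lemma continuous_weylBlock (a : ℕ → ℕ → ℝ) (r₁ r₂ : ℝ) (i : ℕ × ℕ) :
    Continuous (weylBlock a r₁ r₂ i) :=
  continuous_finsetSum _ fun _ _ => continuous_finsetSum _ fun _ _ => continuous_const.mul
    (((continuous_weylCos _ _).comp continuous_fst).mul
      ((continuous_weylCos _ _).comp continuous_snd))

lemma enorm_weylBlock_le {a : ℕ → ℕ → ℝ} (ha : DoublyMonotone a) {r₁ r₂ : ℝ} (hr₁ : 0 ≤ r₁)
    (hr₂ : 0 ≤ r₂) (i : ℕ × ℕ) {z : ℝ × ℝ} (hz₁ : z.1 ∈ Set.Ioo 0 (2 * π))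
    (hz₂ : z.2 ∈ Set.Ioo 0 (2 * π)) : ‖weylBlock a r₁ r₂ i z‖ₑ ≤
      ENNReal.ofReal (weylBound r₁ i.1 * weylBound r₂ i.2 * a (2 ^ i.1) (2 ^ i.2)) *
        (blockMajorant i.1 z.1 * blockMajorant i.2 z.2) := by
  have h := ha.abs_sum_sum_le (fun μ => weylCos r₁ μ z.1) (fun ν => weylCos r₂ ν z.2) _ _
    Nat.one_le_two_pow Nat.one_le_two_pow
    (Nat.pow_le_pow_right two_pos i.1.le_succ) (Nat.pow_le_pow_right two_pos i.2.le_succ)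
    (fun j hj => abs_sum_weylCos_le hr₁ hz₁ i.1 _ j hj)
    (fun j hj => abs_sum_weylCos_le hr₂ hz₂ i.2 _ j hj)
  have h₁ := weylBound_pos r₁ i.1
  have h₂ := weylBound_pos r₂ i.2
  have h₃ := ha.corner_nonneg i
  have e₁ := edgeDist_pos hz₁
  rw [Real.enorm_eq_ofReal_abs, blockMajorant, blockMajorant, ← ENNReal.ofReal_mul (by positivity),
    ← ENNReal.ofReal_mul (by positivity)]
  refine ENNReal.ofReal_le_ofReal (h.trans_eq ?_)
  ring

lemma weylBound_mul_rpow {p : ℝ} {t : ℝ} (ht : 0 ≤ t) (r₁ r₂ : ℝ) (k l : ℕ) :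
    (weylBound r₁ k * weylBound r₂ l * t) ^ p * (2 ^ (k * (p - 1)) * 2 ^ (l * (p - 1))) =
      (2 * 2 ^ r₁ * (2 * 2 ^ r₂)) ^ p *
        (t ^ p * (2 ^ (k * (r₁ * p + p - 1)) * 2 ^ (l * (r₂ * p + p - 1)))) := by
  have e : ∀ (k : ℕ) (r : ℝ), (2:ℝ) ^ (k * (r * p + p - 1)) =
      (2 ^ (k * r)) ^ p * 2 ^ (k * (p - 1)) :=
    fun k r => by rw [← rpow_mul two_pos.le, ← rpow_add two_pos]; ring_nf
  rw [e, e, weylBound, weylBound,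
    show 2 * 2 ^ r₁ * (2:ℝ) ^ (k * r₁) * (2 * 2 ^ r₂ * 2 ^ (l * r₂)) * t =
    (2 * 2 ^ r₁ * (2 * 2 ^ r₂)) * (t * (2 ^ (k * r₁) * 2 ^ (l * r₂))) by ring,
    mul_rpow (by positivity) (by positivity), mul_rpow ht (by positivity),
    mul_rpow (by positivity) (by positivity), mul_rpow (x := 2 ^ (k * r₁)) (by positivity)
    (by positivity)]
  ring

lemma lintegral_tsum_weylBlock_rpow_le {p r₁ r₂ : ℝ} (hp : 1 < p) (hr₁ : 0 ≤ r₁) (hr₂ : 0 ≤ r₂) :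
    ∃ C : ℝ≥0, ∀ a, DoublyMonotone a →
      ∫⁻ z, (∑' i, ‖weylBlock a r₁ r₂ i z‖ₑ) ^ p ∂(periodMeasure.prod periodMeasure) ≤
        C * hardyLittlewoodSum a p r₁ r₂ := by
  obtain ⟨C₁, h₁⟩ := lintegral_tsum_blockMajorant_rpow_le hp
  obtain ⟨C₂, h₂⟩ := tsum_cornerTerm_le p r₁ r₂ (by positivity)
  refine ⟨C₁ * (((2 * 2 ^ r₁ * (2 * 2 ^ r₂)) ^ p : ℝ).toNNReal * C₂), fun a ha => ?_⟩
  calc _ ≤ ∫⁻ z, (∑' i : ℕ × ℕ,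
        ENNReal.ofReal (weylBound r₁ i.1 * weylBound r₂ i.2 * a (2 ^ i.1) (2 ^ i.2)) *
          (blockMajorant i.1 z.1 * blockMajorant i.2 z.2)) ^ p
          ∂(periodMeasure.prod periodMeasure) := by
        refine lintegral_mono_ae (ae_prod_mem_Ioo.mono fun z hz => ?_)
        gcongr with i
        exact enorm_weylBlock_le ha hr₁ hr₂ i hz.1 hz.2
    _ ≤ _ := h₁ _
    _ = C₁ * (((2 * 2 ^ r₁ * (2 * 2 ^ r₂)) ^ p : ℝ).toNNReal *
          ∑' i, ENNReal.ofReal (cornerTerm a p r₁ r₂ i)) := by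
        rw [← ENNReal.tsum_mul_left (f := fun i => ENNReal.ofReal (cornerTerm a p r₁ r₂ i))]
        refine congrArg ((C₁ : ℝ≥0∞) * ·) (tsum_congr fun i => ?_)
        have h₃ := ha.corner_nonneg i
        have h₄ := weylBound_pos r₁ i.1
        have h₅ := weylBound_pos r₂ i.2
        rw [← ENNReal.ofReal_mul (by positivity), ENNReal.ofReal_rpow_of_nonneg (by positivity)
          (by positivity), ← ENNReal.ofReal_mul (by positivity), weylBound_mul_rpow h₃,
          ENNReal.ofReal_mul (by positivity)]
        rfl
    _ ≤ C₁ * (((2 * 2 ^ r₁ * (2 * 2 ^ r₂)) ^ p : ℝ).toNNReal *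
          (C₂ * hardyLittlewoodSum a p r₁ r₂)) := by
        gcongr
        exact h₂ a ha
    _ = _ := by push_cast; ring

lemma integral_weylBlock_mul_expWave (a : ℕ → ℕ → ℝ) (r₁ r₂ : ℝ) (i : ℕ × ℕ) (m₁ m₂ : ℤ) :
    ∫ z, (weylBlock a r₁ r₂ i z : ℂ) * (expWave m₁ z.1 * expWave m₂ z.2)
      ∂(periodMeasure.prod periodMeasure) =
    if m₁.natAbs ∈ blockIco i.1 ∧ m₂.natAbs ∈ blockIco i.2 then
      π ^ 2 * ((Complex.I * m₁) ^ (r₁ : ℂ) * (Complex.I * m₂) ^ (r₂ : ℂ)) *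
        a m₁.natAbs m₂.natAbs else 0 := by
  have e : ∀ z : ℝ × ℝ, (weylBlock a r₁ r₂ i z : ℂ) * (expWave m₁ z.1 * expWave m₂ z.2) =
      ∑ μ ∈ blockIco i.1, ∑ ν ∈ blockIco i.2, (a μ ν : ℂ) *
        (((weylCos r₁ μ z.1 : ℂ) * expWave m₁ z.1) *
          ((weylCos r₂ ν z.2 : ℂ) * expWave m₂ z.2)) := by
    intro z
    simp only [weylBlock, Complex.ofReal_sum, Finset.sum_mul, Complex.ofReal_mul]
    refine Finset.sum_congr rfl fun μ _ => Finset.sum_congr rfl fun ν _ => by ring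
  have hb : ∀ (r : ℝ) (μ : ℕ) (m : ℤ),
      Integrable (fun x => (weylCos r μ x : ℂ) * expWave m x) periodMeasure := fun r μ m => by
    refine Integrable.mul_expWave (Integrable.of_bound (C := (μ : ℝ) ^ r)
      (Complex.continuous_ofReal.comp (continuous_weylCos r μ)).aestronglyMeasurable
        (Filter.Eventually.of_forall fun x => ?_)) m
    rw [Function.comp_apply, Complex.norm_real, weylCos, norm_mul,
      Real.norm_of_nonneg (by positivity)]
    exact mul_le_of_le_one_right (by positivity) (abs_cos_le_one _)
  have hi : ∀ μ ν, Integrable (fun z : ℝ × ℝ => (a μ ν : ℂ) *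
      (((weylCos r₁ μ z.1 : ℂ) * expWave m₁ z.1) * ((weylCos r₂ ν z.2 : ℂ) * expWave m₂ z.2)))
      (periodMeasure.prod periodMeasure) := fun μ ν => ((hb _ _ _).mul_prod (hb _ _ _)).const_mul _
  rw [integral_congr_ae (Filter.Eventually.of_forall e), integral_finsetSum _ fun μ _ =>
    integrable_finsetSum _ fun ν _ => hi μ ν]
  have e2 : ∀ μ ∈ blockIco i.1, ∫ z : ℝ × ℝ, ∑ ν ∈ blockIco i.2, (a μ ν : ℂ) *
      (((weylCos r₁ μ z.1 : ℂ) * expWave m₁ z.1) * ((weylCos r₂ ν z.2 : ℂ) * expWave m₂ z.2))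
      ∂(periodMeasure.prod periodMeasure) = if m₁.natAbs = μ then
        if m₂.natAbs ∈ blockIco i.2 then π ^ 2 * ((Complex.I * m₁) ^ (r₁ : ℂ) *
          (Complex.I * m₂) ^ (r₂ : ℂ)) * a m₁.natAbs m₂.natAbs else 0 else 0 := by
    intro μ hμ
    rw [integral_finsetSum _ fun ν _ => hi μ ν]
    have : ∀ ν ∈ blockIco i.2, ∫ z : ℝ × ℝ, (a μ ν : ℂ) *
      (((weylCos r₁ μ z.1 : ℂ) * expWave m₁ z.1) * ((weylCos r₂ ν z.2 : ℂ) * expWave m₂ z.2))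
      ∂(periodMeasure.prod periodMeasure) = if m₂.natAbs = ν then (if m₁.natAbs = μ then
        π ^ 2 * ((Complex.I * m₁) ^ (r₁ : ℂ) *
          (Complex.I * m₂) ^ (r₂ : ℂ)) * a m₁.natAbs m₂.natAbs else 0) else 0 := by
      intro ν hν
      rw [integral_const_mul, integral_prod_mul
        (fun x => (weylCos r₁ μ x : ℂ) * expWave m₁ x)
        (fun y => (weylCos r₂ ν y : ℂ) * expWave m₂ y),
        integral_weylCos_mul_expWave (one_le_of_mem_blockIco hμ),
        integral_weylCos_mul_expWave (one_le_of_mem_blockIco hν)]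
      split_ifs with h1 h2 <;> simp_all
      ring
    rw [Finset.sum_congr rfl this, Finset.sum_ite_eq]
    split_ifs <;> rfl
  rw [Finset.sum_congr rfl e2, Finset.sum_ite_eq]
  split_ifs <;> simp_all

/-- The Weyl derivative of `∑ a μ ν cos (μ x) cos (ν y)`, summed over dyadic blocks. -/
def weylSeries (a : ℕ → ℕ → ℝ) (r₁ r₂ x y : ℝ) : ℝ := ∑' i, weylBlock a r₁ r₂ i (x, y)

lemma measurable_weylSeries (a : ℕ → ℕ → ℝ) (r₁ r₂ : ℝ) :
    Measurable (Function.uncurry (weylSeries a r₁ r₂)) :=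
  Measurable.tsum fun i => (continuous_weylBlock a r₁ r₂ i).measurable

lemma periodic_weylSeries_left (a : ℕ → ℕ → ℝ) (r₁ r₂ y : ℝ) :
    Function.Periodic (fun x => weylSeries a r₁ r₂ x y) (2 * π) := fun x => by
  simp only [weylSeries, weylBlock, (periodic_weylCos _ _) x]

lemma periodic_weylSeries_right (a : ℕ → ℕ → ℝ) (r₁ r₂ x : ℝ) :
    Function.Periodic (weylSeries a r₁ r₂ x) (2 * π) := fun y => by
  simp only [weylSeries, weylBlock, (periodic_weylCos _ _) y]

lemma lintegral_weylSeries_rpow_le (a : ℕ → ℕ → ℝ) (r₁ r₂ : ℝ) {p : ℝ} (hp : 0 ≤ p) :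
    ∫⁻ z : ℝ × ℝ, ENNReal.ofReal (|weylSeries a r₁ r₂ z.1 z.2| ^ p)
      ∂(periodMeasure.prod periodMeasure) ≤
    ∫⁻ z, (∑' i, ‖weylBlock a r₁ r₂ i z‖ₑ) ^ p ∂(periodMeasure.prod periodMeasure) := by
  refine lintegral_mono fun z => ?_
  rw [ofReal_abs_rpow_eq hp]
  gcongr
  exact enorm_tsum_le_tsum_enorm

lemma integral_weylSeries_mul_expWave {a : ℕ → ℕ → ℝ} {r₁ r₂ p : ℝ} (hp : 1 ≤ p)
    (H : ∫⁻ z, (∑' i, ‖weylBlock a r₁ r₂ i z‖ₑ) ^ p ∂(periodMeasure.prod periodMeasure) ≠ ⊤)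
    (m₁ m₂ : ℤ) :
    ∫ z : ℝ × ℝ, (weylSeries a r₁ r₂ z.1 z.2 : ℂ) * (expWave m₁ z.1 * expWave m₂ z.2)
      ∂(periodMeasure.prod periodMeasure) =
    if m₁ = 0 ∨ m₂ = 0 then 0 else π ^ 2 * ((Complex.I * m₁) ^ (r₁ : ℂ) *
      (Complex.I * m₂) ^ (r₂ : ℂ)) * a m₁.natAbs m₂.natAbs := by
  have hm : ∀ i, Continuous fun z : ℝ × ℝ =>
      (weylBlock a r₁ r₂ i z : ℂ) * (expWave m₁ z.1 * expWave m₂ z.2) := fun i =>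
    (Complex.continuous_ofReal.comp (continuous_weylBlock a r₁ r₂ i)).mul
      (((continuous_expWave m₁).comp continuous_fst).mul
        ((continuous_expWave m₂).comp continuous_snd))
  have hfin : ∑' i, ∫⁻ z : ℝ × ℝ, ‖(weylBlock a r₁ r₂ i z : ℂ) *
      (expWave m₁ z.1 * expWave m₂ z.2)‖ₑ ∂(periodMeasure.prod periodMeasure) ≠ ⊤ := by
    rw [← lintegral_tsum fun i => (hm i).measurable.enorm.aemeasurable]
    refine ne_top_of_le_ne_top (b := ∫⁻ z, (1 + (∑' i, ‖weylBlock a r₁ r₂ i z‖ₑ) ^ p)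
      ∂(periodMeasure.prod periodMeasure)) ?_ (lintegral_mono fun z => ?_)
    · rw [lintegral_add_left measurable_const]
      exact ENNReal.add_ne_top.2 ⟨by simp, H⟩
    · have : ∀ i, ‖(weylBlock a r₁ r₂ i z : ℂ) * (expWave m₁ z.1 * expWave m₂ z.2)‖ₑ =
          ‖weylBlock a r₁ r₂ i z‖ₑ := fun i => by
        rw [enorm_eq_iff_norm_eq]
        simp [norm_expWave]
      simp only [this]
      generalize ∑' i, ‖weylBlock a r₁ r₂ i z‖ₑ = t
      rcases le_total t 1 with ht | ht
      · exact ht.trans le_self_add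
      · exact (ENNReal.le_rpow_self_of_one_le ht hp).trans le_add_self
  have e : ∀ z : ℝ × ℝ, (weylSeries a r₁ r₂ z.1 z.2 : ℂ) * (expWave m₁ z.1 * expWave m₂ z.2) =
      ∑' i, (weylBlock a r₁ r₂ i z : ℂ) * (expWave m₁ z.1 * expWave m₂ z.2) := fun z => by
    rw [tsum_mul_right, weylSeries, Complex.ofReal_tsum]
  rw [integral_congr_ae (Filter.Eventually.of_forall e),
    integral_tsum (fun i => (hm i).aestronglyMeasurable) hfin]
  simp only [integral_weylBlock_mul_expWave]
  split_ifs with h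
  · refine (tsum_congr fun i => if_neg fun hi => ?_).trans tsum_zero
    have h₁ := one_le_of_mem_blockIco hi.1
    have h₂ := one_le_of_mem_blockIco hi.2
    omega
  · have h₁ : 1 ≤ m₁.natAbs := by omega
    have h₂ : 1 ≤ m₂.natAbs := by omega
    rw [tsum_eq_single (Nat.log 2 m₁.natAbs, Nat.log 2 m₂.natAbs)]
    · exact if_pos ⟨(mem_blockIco_iff h₁).2 rfl, (mem_blockIco_iff h₂).2 rfl⟩
    · refine fun i hi => if_neg fun hmem => hi ?_
      exact Prod.ext ((mem_blockIco_iff h₁).1 hmem.1) ((mem_blockIco_iff h₂).1 hmem.2)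

/-- The Fourier coefficients of a function in the class `M_p`. -/
lemma InMclass.fourierCoefZ_eq {p : ℝ} (hp : 1 ≤ p) {f : ℝ → ℝ → ℝ} {a : ℕ → ℕ → ℝ}
    (h : InMclass p f a) (m₁ m₂ : ℤ) : fourierCoefZ f m₁ m₂ =
      if m₁ = 0 ∨ m₂ = 0 then 0 else ((a m₁.natAbs m₂.natAbs / 4 : ℝ) : ℂ) := by
  rw [fourierCoefZ_eq_fourierCC (h.1.integrable hp) h.2.2.1]
  split_ifs with h0
  · rcases h0 with rfl | rfl
    · simp [fourierCC_zero_left hp h.1]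
    · simp [fourierCC_zero_right hp h.1]
  · rw [h.2.1 _ _ (by omega) (by omega)]

lemma ae_integral_eq_zero_of_forall_integral_mul_expWave_eq_zero {g : ℝ → ℝ → ℝ}
    (hg : Integrable (fun z : ℝ × ℝ => g z.1 z.2) (periodMeasure.prod periodMeasure))
    (hper : ∀ y, Function.Periodic (fun x => g x y) (2 * π))
    (h : ∀ m : ℤ, ∫ z : ℝ × ℝ, (g z.1 z.2 : ℂ) * (expWave m z.1 * expWave 0 z.2)
      ∂(periodMeasure.prod periodMeasure) = 0) :
    ∀ᵐ x : ℝ, ∫ y in (0:ℝ)..(2 * π), g x y = 0 := by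
  have hgc : Integrable (fun z : ℝ × ℝ => (g z.1 z.2 : ℂ)) (periodMeasure.prod periodMeasure) :=
    hg.ofReal
  refine ae_integral_eq_zero_of_periodic (fun x => ?_)
    ((ae_integral_mul_expWave_eq_zero hgc 0 h).mono fun x hx => ?_)
  · exact intervalIntegral.integral_congr fun y _ => hper y x
  · rw [intervalIntegral.integral_of_le two_pi_pos.le]
    simp only [expWave, Int.cast_zero, zero_mul, mul_zero, Complex.exp_zero, mul_one] at hx
    rw [integral_complex_ofReal] at hx
    exact_mod_cast hx

/-- If the Hardy–Littlewood sum is finite, the dyadic series is the mixed Weyl derivative. -/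
lemma InMclass.hasWeylDeriv_weylSeries {p r₁ r₂ : ℝ} (hp : 1 ≤ p) {f : ℝ → ℝ → ℝ}
    {a : ℕ → ℕ → ℝ} (hf : InMclass p f a)
    (H : ∫⁻ z, (∑' i, ‖weylBlock a r₁ r₂ i z‖ₑ) ^ p ∂(periodMeasure.prod periodMeasure) ≠ ⊤) :
    HasWeylDeriv p r₁ r₂ f (weylSeries a r₁ r₂) := by
  have hp0 : 0 ≤ p := by linarith
  have hm := measurable_weylSeries a r₁ r₂
  have hfin := ne_top_of_le_ne_top H (lintegral_weylSeries_rpow_le a r₁ r₂ hp0)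
  have hi := integrable_of_lintegral_rpow_ne_top hm hp hfin
  have hcoef := integral_weylSeries_mul_expWave hp H
  refine ⟨⟨hm, periodic_weylSeries_left a r₁ r₂, periodic_weylSeries_right a r₁ r₂, ?_, ?_, ?_⟩, ?_⟩
  · rw [Lp2Norm_eq hm]
    exact ENNReal.rpow_ne_top_of_nonneg (by positivity) hfin
  · refine ae_integral_eq_zero_of_forall_integral_mul_expWave_eq_zero
      (g := fun y x => weylSeries a r₁ r₂ x y) hi.swap (periodic_weylSeries_right a r₁ r₂)
      fun m => ?_
    rw [← integral_prod_swap]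
    refine Eq.trans (integral_congr_ae (Filter.Eventually.of_forall fun z => ?_))
      ((hcoef 0 m).trans (if_pos (Or.inl rfl)))
    simp only [Prod.fst_swap, Prod.snd_swap]
    ring
  · exact ae_integral_eq_zero_of_forall_integral_mul_expWave_eq_zero hi
      (periodic_weylSeries_left a r₁ r₂) fun m => (hcoef m 0).trans (if_pos (Or.inr rfl))
  · intro m₁ m₂
    rw [_root_.fourierCoefZ_eq hi, hcoef, hf.fourierCoefZ_eq hp]
    split_ifs with h
    · simp
    · have : (π : ℂ) ≠ 0 := by exact_mod_cast pi_ne_zero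
      push_cast
      field_simp
      ring

/-- The upper estimate: every mixed Weyl derivative is controlled by the
Hardy–Littlewood sum, and exists if the latter is finite. -/
lemma exists_Lp2Norm_le_MclassSum {p r₁ r₂ : ℝ} (hp : 1 < p) (hr₁ : 0 ≤ r₁) (hr₂ : 0 ≤ r₂) :
    ∃ C : ℝ≥0, 0 < C ∧ ∀ (f : ℝ → ℝ → ℝ) (a : ℕ → ℕ → ℝ), InMclass p f a →
      (MclassSum a p r₁ r₂ ≠ ⊤ → ∃ g, HasWeylDeriv p r₁ r₂ f g) ∧
      ∀ g, HasWeylDeriv p r₁ r₂ f g → Lp2Norm p g ≤ C * MclassSum a p r₁ r₂ := by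
  obtain ⟨C, hC⟩ := lintegral_tsum_weylBlock_rpow_le hp hr₁ hr₂
  have hp0 : 0 < p := by linarith
  refine ⟨(C + 1) ^ (1 / p), by positivity, fun f a hf => ?_⟩
  have hle := hC a (hf.doublyMonotone hp.le)
  have H : MclassSum a p r₁ r₂ ≠ ⊤ →
      ∫⁻ z, (∑' i, ‖weylBlock a r₁ r₂ i z‖ₑ) ^ p ∂(periodMeasure.prod periodMeasure) ≠ ⊤ := by
    refine fun h => ne_top_of_le_ne_top (ENNReal.mul_ne_top ENNReal.coe_ne_top fun ht => h ?_) hle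
    change hardyLittlewoodSum a p r₁ r₂ ^ (1 / p) = ⊤
    rw [ht, ENNReal.top_rpow_of_pos (by positivity)]
  refine ⟨fun h => ⟨_, hf.hasWeylDeriv_weylSeries hp.le (H h)⟩, fun g hg => ?_⟩
  by_cases h : MclassSum a p r₁ r₂ = ⊤
  · rw [h, ENNReal.mul_top (by exact_mod_cast (by positivity : (C + 1) ^ (1 / p) ≠ 0))]
    exact le_top
  have hw := hf.hasWeylDeriv_weylSeries hp.le (H h)
  have hae := ae_eq_of_fourierCoefZ_eq hg.1.meas hw.1.meas (hg.1.integrable hp.le)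
    (hw.1.integrable hp.le) fun m₁ m₂ => by rw [hg.2, hw.2]
  change _ ≤ _ * hardyLittlewoodSum a p r₁ r₂ ^ (1 / p)
  rw [Lp2Norm_eq hg.1.meas, ENNReal.coe_rpow_of_nonneg _ (by positivity),
    ← ENNReal.mul_rpow_of_nonneg _ _ (by positivity)]
  gcongr
  calc _ = ∫⁻ z : ℝ × ℝ, ENNReal.ofReal (|weylSeries a r₁ r₂ z.1 z.2| ^ p)
        ∂(periodMeasure.prod periodMeasure) :=
        lintegral_congr_ae (hae.mono fun z hz => by simp only [hz])
    _ ≤ _ := lintegral_weylSeries_rpow_le a r₁ r₂ hp0.le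
    _ ≤ _ := hle
    _ ≤ _ := by gcongr; simp

/-- The sum of `weylCos r` over the dyadic block `2 ^ k / 2 < ν ≤ 2 ^ k`. -/
def weylKernel (r : ℝ) (k : ℕ) (x : ℝ) : ℝ := ∑ ν ∈ blockIoc k, weylCos r ν x

lemma continuous_weylKernel (r : ℝ) (k : ℕ) : Continuous (weylKernel r k) :=
  continuous_finsetSum _ fun _ _ => continuous_weylCos _ _

lemma enorm_weylKernel_le {r : ℝ} (hr : 0 ≤ r) {x : ℝ} (hx : x ∈ Set.Ioo 0 (2 * π)) (k : ℕ) :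
    ‖weylKernel r k x‖ₑ ≤ ENNReal.ofReal (weylBound r k) * blockMajorant k x := by
  rw [Real.enorm_eq_ofReal_abs, blockMajorant, ← ENNReal.ofReal_mul (weylBound_pos r k).le]
  refine ENNReal.ofReal_le_ofReal ?_
  have e : blockIoc k = Finset.Ico (2 ^ k / 2 + 1) (2 ^ k + 1) := by
    ext ν
    simp only [blockIoc, Finset.mem_Ioc, Finset.mem_Ico]
    omega
  rw [weylKernel, e]
  refine abs_sum_weylCos_le hr hx k _ _ ?_
  have := Nat.one_le_two_pow (n := k)
  rw [pow_succ]
  omega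

/-- The coefficient of the test function at the dyadic corner `(2 ^ k, 2 ^ l)`. -/
def dualCoef (a : ℕ → ℕ → ℝ) (p r₁ r₂ : ℝ) (i : ℕ × ℕ) : ℝ :=
  a (2 ^ i.1) (2 ^ i.2) ^ (p - 1) *
    ((2:ℝ) ^ (i.1 * ((p - 2) * (r₁ + 1))) * (2:ℝ) ^ (i.2 * ((p - 2) * (r₂ + 1))))

lemma DoublyMonotone.dualCoef_nonneg {a : ℕ → ℕ → ℝ} (ha : DoublyMonotone a) (p r₁ r₂ : ℝ)
    (i : ℕ × ℕ) : 0 ≤ dualCoef a p r₁ r₂ i := by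
  have := rpow_nonneg (ha.corner_nonneg i) (p - 1)
  unfold dualCoef
  positivity

lemma DoublyMonotone.dualCoef_mul {a : ℕ → ℕ → ℝ} (ha : DoublyMonotone a) {p : ℝ} (hp : 1 < p)
    (r₁ r₂ : ℝ) (i : ℕ × ℕ) : dualCoef a p r₁ r₂ i * (a (2 ^ i.1) (2 ^ i.2) *
      ((2:ℝ) ^ (i.1 * (2 * r₁ + 1)) * (2:ℝ) ^ (i.2 * (2 * r₂ + 1)))) = cornerTerm a p r₁ r₂ i := by
  have e : ∀ (k : ℕ) (r : ℝ), (2:ℝ) ^ (k * (r * p + p - 1)) =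
      2 ^ (k * ((p - 2) * (r + 1))) * 2 ^ (k * (2 * r + 1)) := fun k r => by
    rw [← rpow_add two_pos]; ring_nf
  have e2 : a (2 ^ i.1) (2 ^ i.2) ^ p =
      a (2 ^ i.1) (2 ^ i.2) ^ (p - 1) * a (2 ^ i.1) (2 ^ i.2) := by
    rw [← rpow_add_one' (ha.corner_nonneg i) (by linarith), sub_add_cancel]
  rw [cornerTerm, dualCoef, e, e, e2]
  ring

lemma DoublyMonotone.dualCoef_rpow {a : ℕ → ℕ → ℝ} (ha : DoublyMonotone a) {p q : ℝ}
    (hpq : p.HolderConjugate q) (r₁ r₂ : ℝ) (i : ℕ × ℕ) : dualCoef a p r₁ r₂ i ^ q *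
      ((2:ℝ) ^ (i.1 * (r₁ * q + q - 1)) * (2:ℝ) ^ (i.2 * (r₂ * q + q - 1))) =
      cornerTerm a p r₁ r₂ i := by
  have h := hpq.sub_one_mul_conj
  have h0 := ha.corner_nonneg i
  have e : ∀ (k : ℕ) (r : ℝ), (2:ℝ) ^ (k * (r * p + p - 1)) =
      (2 ^ (k * ((p - 2) * (r + 1)))) ^ q * 2 ^ (k * (r * q + q - 1)) := fun k r => by
    rw [← rpow_mul two_pos.le, ← rpow_add two_pos]
    congr 1
    linear_combination (-(k : ℝ) * (r + 1)) * h
  rw [cornerTerm, dualCoef, mul_rpow (by positivity) (by positivity),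
    mul_rpow (by positivity) (by positivity), ← rpow_mul h0, h, e, e]
  ring

/-- The test function used in the lower estimate. -/
def dualSum (a : ℕ → ℕ → ℝ) (p r₁ r₂ : ℝ) (F : Finset (ℕ × ℕ)) (z : ℝ × ℝ) : ℝ :=
  ∑ i ∈ F, dualCoef a p r₁ r₂ i * (weylKernel r₁ i.1 z.1 * weylKernel r₂ i.2 z.2)

lemma continuous_dualSum (a : ℕ → ℕ → ℝ) (p r₁ r₂ : ℝ) (F : Finset (ℕ × ℕ)) :
    Continuous (dualSum a p r₁ r₂ F) :=
  continuous_finsetSum _ fun _ _ => continuous_const.mul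
    (((continuous_weylKernel _ _).comp continuous_fst).mul
      ((continuous_weylKernel _ _).comp continuous_snd))

lemma lintegral_dualSum_rpow_le {p q r₁ r₂ : ℝ} (hpq : p.HolderConjugate q) (hr₁ : 0 ≤ r₁)
    (hr₂ : 0 ≤ r₂) : ∃ C : ℝ≥0, ∀ a, DoublyMonotone a → ∀ F : Finset (ℕ × ℕ),
      ∫⁻ z, ‖dualSum a p r₁ r₂ F z‖ₑ ^ q ∂(periodMeasure.prod periodMeasure) ≤
        C * ENNReal.ofReal (∑ i ∈ F, cornerTerm a p r₁ r₂ i) := by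
  obtain ⟨C, hC⟩ := lintegral_tsum_blockMajorant_rpow_le hpq.symm.lt
  have hq := hpq.symm.pos
  refine ⟨C * ((2 * 2 ^ r₁ * (2 * 2 ^ r₂)) ^ q : ℝ).toNNReal, fun a ha F => ?_⟩
  let d : ℕ × ℕ → ℝ≥0∞ := fun i => if i ∈ F then
    ENNReal.ofReal (weylBound r₁ i.1 * weylBound r₂ i.2 * dualCoef a p r₁ r₂ i) else 0
  calc _ ≤ ∫⁻ z, (∑' i, d i * (blockMajorant i.1 z.1 * blockMajorant i.2 z.2)) ^ q
          ∂(periodMeasure.prod periodMeasure) := by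
        refine lintegral_mono_ae (ae_prod_mem_Ioo.mono fun z hz => ?_)
        gcongr
        rw [tsum_eq_sum (s := F) fun i hi => by simp [d, hi]]
        refine (enorm_sum_le _ _).trans (Finset.sum_le_sum fun i hi => ?_)
        have h₁ := weylBound_pos r₁ i.1
        have h₂ := weylBound_pos r₂ i.2
        rw [enorm_mul, enorm_mul, Real.enorm_of_nonneg (ha.dualCoef_nonneg p r₁ r₂ i)]
        simp only [d, if_pos hi]
        rw [ENNReal.ofReal_mul (by positivity), ENNReal.ofReal_mul (by positivity)]
        calc _ ≤ ENNReal.ofReal (dualCoef a p r₁ r₂ i) *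
              ((ENNReal.ofReal (weylBound r₁ i.1) * blockMajorant i.1 z.1) *
                (ENNReal.ofReal (weylBound r₂ i.2) * blockMajorant i.2 z.2)) := by
              gcongr
              · exact enorm_weylKernel_le hr₁ hz.1 _
              · exact enorm_weylKernel_le hr₂ hz.2 _
          _ = _ := by ring
    _ ≤ _ := hC d
    _ = _ := by
        rw [tsum_eq_sum (s := F) fun i hi => by simp [d, hi, hq],
          ENNReal.ofReal_sum_of_nonneg fun i _ => ha.cornerTerm_nonneg p r₁ r₂ i, ENNReal.coe_mul,
          mul_assoc, Finset.mul_sum (f := fun i => ENNReal.ofReal (cornerTerm a p r₁ r₂ i))]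
        congr 1
        refine Finset.sum_congr rfl fun i hi => ?_
        have h₁ := weylBound_pos r₁ i.1
        have h₂ := weylBound_pos r₂ i.2
        have h₃ := ha.dualCoef_nonneg p r₁ r₂ i
        simp only [d, if_pos hi]
        rw [← ENNReal.ofReal_mul (by positivity), ENNReal.ofReal_rpow_of_nonneg (by positivity)
          hq.le, ← ENNReal.ofReal_mul (by positivity), weylBound_mul_rpow h₃,
          ha.dualCoef_rpow hpq, ENNReal.ofReal_mul (by positivity)]
        rfl

lemma sum_cornerTerm_le_integral_mul_dualSum {p r₁ r₂ : ℝ} (hp : 1 < p) {f g : ℝ → ℝ → ℝ}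
    {a : ℕ → ℕ → ℝ} (hf : InMclass p f a) (hg : HasWeylDeriv p r₁ r₂ f g) (F : Finset (ℕ × ℕ)) :
    π ^ 2 * ∑ i ∈ F, cornerTerm a p r₁ r₂ i ≤ 2 ^ (1 + |2 * r₁|) * 2 ^ (1 + |2 * r₂|) *
      ∫ z : ℝ × ℝ, g z.1 z.2 * dualSum a p r₁ r₂ F z ∂(periodMeasure.prod periodMeasure) := by
  have ha := hf.doublyMonotone hp.le
  have hgi := hg.1.integrable hp.le
  have hi : ∀ μ ν, Integrable (fun z : ℝ × ℝ => g z.1 z.2 * (weylCos r₁ μ z.1 * weylCos r₂ ν z.2))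
      (periodMeasure.prod periodMeasure) := fun μ ν => by
    refine hgi.mul_bdd (c := (μ : ℝ) ^ r₁ * (ν : ℝ) ^ r₂) (((continuous_weylCos _ _).comp
      continuous_fst).mul ((continuous_weylCos _ _).comp continuous_snd)).aestronglyMeasurable
      (Filter.Eventually.of_forall fun z => ?_)
    have h : ∀ (r : ℝ) (μ : ℕ) (x : ℝ), ‖weylCos r μ x‖ ≤ (μ : ℝ) ^ r := fun r μ x => by
      rw [weylCos, norm_mul, Real.norm_of_nonneg (by positivity)]
      exact mul_le_of_le_one_right (by positivity) (abs_cos_le_one _)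
    rw [norm_mul]
    exact mul_le_mul (h _ _ _) (h _ _ _) (norm_nonneg _) (by positivity)
  have e : ∀ z : ℝ × ℝ, g z.1 z.2 * dualSum a p r₁ r₂ F z = ∑ i ∈ F, ∑ μ ∈ blockIoc i.1,
      ∑ ν ∈ blockIoc i.2, dualCoef a p r₁ r₂ i *
        (g z.1 z.2 * (weylCos r₁ μ z.1 * weylCos r₂ ν z.2)) := fun z => by
    rw [dualSum, Finset.mul_sum]
    refine Finset.sum_congr rfl fun i _ => ?_
    rw [weylKernel, weylKernel, Finset.sum_mul_sum, Finset.mul_sum, Finset.mul_sum]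
    refine Finset.sum_congr rfl fun μ _ => ?_
    rw [Finset.mul_sum, Finset.mul_sum]
    exact Finset.sum_congr rfl fun ν _ => by ring
  rw [integral_congr_ae (Filter.Eventually.of_forall e), integral_finsetSum _ fun i _ =>
    integrable_finsetSum _ fun μ _ => integrable_finsetSum _ fun ν _ => (hi μ ν).const_mul _,
    Finset.mul_sum, Finset.mul_sum]
  refine Finset.sum_le_sum fun i _ => ?_
  rw [integral_finsetSum _ fun μ _ => integrable_finsetSum _ fun ν _ => (hi μ ν).const_mul _]
  have h0 := ha.dualCoef_nonneg p r₁ r₂ i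
  have h1 := ha.corner_nonneg i
  have hlow : dualCoef a p r₁ r₂ i * (π ^ 2 * (a (2 ^ i.1) (2 ^ i.2) *
      ((∑ μ ∈ blockIoc i.1, (μ : ℝ) ^ (2 * r₁)) * ∑ ν ∈ blockIoc i.2, (ν : ℝ) ^ (2 * r₂)))) ≤
      ∑ μ ∈ blockIoc i.1, ∫ z : ℝ × ℝ, ∑ ν ∈ blockIoc i.2, dualCoef a p r₁ r₂ i *
        (g z.1 z.2 * (weylCos r₁ μ z.1 * weylCos r₂ ν z.2))
        ∂(periodMeasure.prod periodMeasure) := by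
    rw [Finset.sum_mul_sum, Finset.mul_sum, Finset.mul_sum, Finset.mul_sum]
    refine Finset.sum_le_sum fun μ hμ => ?_
    rw [integral_finsetSum _ fun ν _ => (hi μ ν).const_mul _, Finset.mul_sum, Finset.mul_sum,
      Finset.mul_sum]
    refine Finset.sum_le_sum fun ν hν => ?_
    have h₁ := one_le_of_mem_blockIoc hμ
    have h₂ := one_le_of_mem_blockIoc hν
    rw [integral_const_mul, integral_mul_weylCos_mul_weylCos hgi hg.2 (a := a μ ν) _ h₁ h₂]
    · gcongr
      exact ha.anti h₁ h₂ (Finset.mem_Ioc.1 hμ).2 (Finset.mem_Ioc.1 hν).2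
    · intro m₁ m₂ e₁ e₂
      rw [hf.fourierCoefZ_eq hp.le, if_neg (by omega), e₁, e₂]
  calc π ^ 2 * cornerTerm a p r₁ r₂ i
      = dualCoef a p r₁ r₂ i * (π ^ 2 * (a (2 ^ i.1) (2 ^ i.2) *
          ((2:ℝ) ^ (i.1 * (2 * r₁ + 1)) * (2:ℝ) ^ (i.2 * (2 * r₂ + 1))))) := by
        rw [← ha.dualCoef_mul hp]
        ring
    _ ≤ dualCoef a p r₁ r₂ i * (π ^ 2 * (a (2 ^ i.1) (2 ^ i.2) *
          ((2 ^ (1 + |2 * r₁|) * ∑ μ ∈ blockIoc i.1, (μ : ℝ) ^ (2 * r₁)) *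
            (2 ^ (1 + |2 * r₂|) * ∑ ν ∈ blockIoc i.2, (ν : ℝ) ^ (2 * r₂))))) := by
        gcongr
        · exact two_rpow_le_sum_blockIoc _ _
        · exact two_rpow_le_sum_blockIoc _ _
    _ = 2 ^ (1 + |2 * r₁|) * 2 ^ (1 + |2 * r₂|) * (dualCoef a p r₁ r₂ i *
          (π ^ 2 * (a (2 ^ i.1) (2 ^ i.2) * ((∑ μ ∈ blockIoc i.1, (μ : ℝ) ^ (2 * r₁)) *
            ∑ ν ∈ blockIoc i.2, (ν : ℝ) ^ (2 * r₂))))) := by ring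
    _ ≤ _ := by gcongr

lemma ENNReal.le_rpow_of_le_mul_rpow {p q : ℝ} (hpq : p.HolderConjugate q) {T M : ℝ≥0∞}
    (hT : T ≠ ⊤) (h : T ≤ M * T ^ (1 / q)) : T ≤ M ^ p := by
  rcases eq_or_ne T 0 with rfl | hT0
  · exact zero_le
  have hq := hpq.symm.pos
  have e : T = T ^ (1 / p) * T ^ (1 / q) := by
    rw [← ENNReal.rpow_add _ _ hT0 hT, one_div, one_div, hpq.inv_add_inv_eq_one, ENNReal.rpow_one]
  have h2 : T ^ (1 / p) ≤ M := by
    refine (ENNReal.mul_le_mul_iff_left (c := T ^ (1 / q)) ?_ ?_).1 (e ▸ h)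
    · exact (ENNReal.rpow_pos (pos_iff_ne_zero.2 hT0) hT).ne'
    · exact ENNReal.rpow_ne_top_of_nonneg (by positivity) hT
  calc T = (T ^ (1 / p)) ^ p := by
        rw [← ENNReal.rpow_mul, one_div, inv_mul_cancel₀ hpq.ne_zero, ENNReal.rpow_one]
    _ ≤ M ^ p := ENNReal.rpow_le_rpow h2 hpq.nonneg

/-- The lower estimate: the Hardy–Littlewood sum is controlled by the norm of the mixed Weyl
derivative. -/
lemma exists_MclassSum_le_Lp2Norm {p r₁ r₂ : ℝ} (hp : 1 < p) (hr₁ : 0 ≤ r₁) (hr₂ : 0 ≤ r₂) :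
    ∃ C : ℝ≥0, ∀ (f : ℝ → ℝ → ℝ) (a : ℕ → ℕ → ℝ), InMclass p f a →
      ∀ g, HasWeylDeriv p r₁ r₂ f g → MclassSum a p r₁ r₂ ≤ C * Lp2Norm p g := by
  have hpq := Real.HolderConjugate.conjExponent hp
  set q := p.conjExponent
  have hp0 : 0 < p := by linarith
  have hq := hpq.symm.pos
  obtain ⟨C₁, h₁⟩ := lintegral_dualSum_rpow_le hpq hr₁ hr₂
  obtain ⟨C₂, h₂⟩ := hardyLittlewoodSum_le p r₁ r₂ hp0.le
  set K : ℝ := (π ^ 2)⁻¹ * (2 ^ (1 + |2 * r₁|) * 2 ^ (1 + |2 * r₂|)) with hK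
  have hK0 : 0 ≤ K := by positivity
  refine ⟨C₂ ^ (1 / p) * (K.toNNReal * C₁ ^ (1 / q)), fun f a hf g hg => ?_⟩
  have ha := hf.doublyMonotone hp.le
  have hmg : Measurable fun z : ℝ × ℝ => ‖g z.1 z.2‖ₑ := hg.1.meas.enorm
  have hF : ∀ F : Finset (ℕ × ℕ), ENNReal.ofReal (∑ i ∈ F, cornerTerm a p r₁ r₂ i) ≤
      (K.toNNReal * C₁ ^ (1 / q) * Lp2Norm p g) ^ p := by
    intro F
    have hmd := (continuous_dualSum a p r₁ r₂ F).measurable.enorm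
    refine ENNReal.le_rpow_of_le_mul_rpow hpq ENNReal.ofReal_ne_top ?_
    have hint : ENNReal.ofReal (∫ z : ℝ × ℝ, g z.1 z.2 * dualSum a p r₁ r₂ F z
        ∂(periodMeasure.prod periodMeasure)) ≤ Lp2Norm p g *
          (C₁ * ENNReal.ofReal (∑ i ∈ F, cornerTerm a p r₁ r₂ i)) ^ (1 / q) := by
      calc _ ≤ ‖∫ z : ℝ × ℝ, g z.1 z.2 * dualSum a p r₁ r₂ F z
            ∂(periodMeasure.prod periodMeasure)‖ₑ := by
            rw [Real.enorm_eq_ofReal_abs]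
            exact ENNReal.ofReal_le_ofReal (le_abs_self _)
        _ ≤ ∫⁻ z : ℝ × ℝ, ‖g z.1 z.2 * dualSum a p r₁ r₂ F z‖ₑ
            ∂(periodMeasure.prod periodMeasure) := enorm_integral_le_lintegral_enorm _
        _ = ∫⁻ z : ℝ × ℝ, ‖g z.1 z.2‖ₑ * ‖dualSum a p r₁ r₂ F z‖ₑ
            ∂(periodMeasure.prod periodMeasure) := by simp only [enorm_mul]
        _ ≤ (∫⁻ z : ℝ × ℝ, ‖g z.1 z.2‖ₑ ^ p ∂(periodMeasure.prod periodMeasure)) ^ (1 / p) *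
            (∫⁻ z, ‖dualSum a p r₁ r₂ F z‖ₑ ^ q ∂(periodMeasure.prod periodMeasure)) ^ (1 / q) :=
            ENNReal.lintegral_mul_le_Lp_mul_Lq _ hpq hmg.aemeasurable hmd.aemeasurable
        _ ≤ _ := by
            rw [Lp2Norm_eq hg.1.meas]
            simp only [ofReal_abs_rpow_eq hp0.le]
            gcongr
            exact h₁ a ha F
    calc ENNReal.ofReal (∑ i ∈ F, cornerTerm a p r₁ r₂ i)
        ≤ ENNReal.ofReal (K * ∫ z : ℝ × ℝ, g z.1 z.2 * dualSum a p r₁ r₂ F z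
            ∂(periodMeasure.prod periodMeasure)) := by
          refine ENNReal.ofReal_le_ofReal ?_
          rw [hK, mul_assoc, ← div_eq_inv_mul, le_div_iff₀' (by positivity)]
          exact sum_cornerTerm_le_integral_mul_dualSum hp hf hg F
      _ ≤ K.toNNReal * (Lp2Norm p g *
          (C₁ * ENNReal.ofReal (∑ i ∈ F, cornerTerm a p r₁ r₂ i)) ^ (1 / q)) := by
          rw [ENNReal.ofReal_mul hK0]
          exact mul_le_mul_right hint _
      _ = _ := by
          rw [ENNReal.mul_rpow_of_nonneg _ _ (by positivity)]
          ring
  have hsum : hardyLittlewoodSum a p r₁ r₂ ≤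
      C₂ * (K.toNNReal * C₁ ^ (1 / q) * Lp2Norm p g) ^ p := by
    refine (h₂ a ha).trans ?_
    gcongr
    rw [ENNReal.tsum_eq_iSup_sum]
    refine iSup_le fun F => ?_
    rw [← ENNReal.ofReal_sum_of_nonneg fun i _ => ha.cornerTerm_nonneg p r₁ r₂ i]
    exact hF F
  calc MclassSum a p r₁ r₂
      ≤ (C₂ * (K.toNNReal * C₁ ^ (1 / q) * Lp2Norm p g) ^ p) ^ (1 / p) :=
        ENNReal.rpow_le_rpow hsum (by positivity)
    _ = _ := by
        rw [ENNReal.mul_rpow_of_nonneg _ _ (by positivity), ← ENNReal.rpow_mul,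
          mul_one_div_cancel hp0.ne', ENNReal.rpow_one, ENNReal.coe_mul, ENNReal.coe_mul,
          ENNReal.coe_rpow_of_nonneg _ (by positivity),
          ENNReal.coe_rpow_of_nonneg _ (by positivity)]
        ring

lemma hasWeylDeriv_zero {p : ℝ} {f : ℝ → ℝ → ℝ} (hf : MemLp0 p f) : HasWeylDeriv p 0 0 f f :=
  ⟨hf, fun m₁ m₂ => by simp⟩

/-- Hardy–Littlewood type theorem for the class `M_p` (Lemma 3.8). -/
theorem hardy_littlewood_Mclass (p r₁ r₂ : ℝ) (hp : 1 < p)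
    (hr₁ : 0 ≤ r₁) (hr₂ : 0 ≤ r₂) :
    ∃ C : ℝ, 0 < C ∧ ∀ (f : ℝ → ℝ → ℝ) (a : ℕ → ℕ → ℝ), InMclass p f a →
      (Lp2Norm p f ≤ ENNReal.ofReal C * MclassSum a p 0 0 ∧
        MclassSum a p 0 0 ≤ ENNReal.ofReal C * Lp2Norm p f) ∧
      ((MclassSum a p r₁ r₂ ≠ ⊤ → ∃ g : ℝ → ℝ → ℝ, HasWeylDeriv p r₁ r₂ f g) ∧
        ∀ g : ℝ → ℝ → ℝ, HasWeylDeriv p r₁ r₂ f g →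
          Lp2Norm p g ≤ ENNReal.ofReal C * MclassSum a p r₁ r₂ ∧
          MclassSum a p r₁ r₂ ≤ ENNReal.ofReal C * Lp2Norm p g) := by
  obtain ⟨A, -, hA⟩ := exists_Lp2Norm_le_MclassSum hp hr₁ hr₂
  obtain ⟨B, hB⟩ := exists_MclassSum_le_Lp2Norm hp hr₁ hr₂
  obtain ⟨A₀, -, hA₀⟩ := exists_Lp2Norm_le_MclassSum hp le_rfl le_rfl
  obtain ⟨B₀, hB₀⟩ := exists_MclassSum_le_Lp2Norm hp le_rfl le_rfl
  set C : ℝ≥0 := A + B + A₀ + B₀ + 1 with hC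
  have weaken {D : ℝ≥0} (hD : D ≤ C) {s t : ℝ≥0∞} (h : s ≤ D * t) :
      s ≤ ENNReal.ofReal C * t := by
    rw [ENNReal.ofReal_coe_nnreal]
    exact h.trans (by gcongr)
  have hAC : A ≤ C := by rw [hC, ← NNReal.coe_le_coe]; push_cast; linarith [B.2, A₀.2, B₀.2]
  have hBC : B ≤ C := by rw [hC, ← NNReal.coe_le_coe]; push_cast; linarith [A.2, A₀.2, B₀.2]
  have hAC₀ : A₀ ≤ C := by rw [hC, ← NNReal.coe_le_coe]; push_cast; linarith [A.2, B.2, B₀.2]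
  have hBC₀ : B₀ ≤ C := by rw [hC, ← NNReal.coe_le_coe]; push_cast; linarith [A.2, B.2, A₀.2]
  refine ⟨C, NNReal.coe_pos.2 (by positivity), fun f a hf ↦ ?_⟩
  have h₀ := hasWeylDeriv_zero hf.1
  exact ⟨⟨weaken hAC₀ ((hA₀ f a hf).2 f h₀), weaken hBC₀ (hB₀ f a hf f h₀)⟩, (hA f a hf).1,
    fun g hg ↦ ⟨weaken hAC ((hA f a hf).2 g hg), weaken hBC (hB f a hf g hg)⟩⟩

end
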